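/- arXiv:0902.1643 — 10 statements merged into one kernel-verified Lean document; each statement's English description precedes it below -/
import Mathlib

section
/- Let σ : [0,∞) → ℝ be continuous with σ(t) ≥ σ₀ for all t ≥ 0, where σ₀ > 0, and let f₁, f₂ : [0,∞) → ℝ be continuous functions lying in L¹([0,∞)) ∩ L^∞([0,∞)). Suppose x₁, x₂ : [0,∞) → ℝ are differentiable and satisfy x₁'(t) − σ(t)·x₁(t) = f₁(t) and x₂'(t) + σ(t)·x₂(t) = f₂(t) for all t ≥ 0. Then the pair (x₁, x₂) is bounded on [0,∞) if and only if 0 = x₁(0) + ∫₀^∞ exp(−∫₀^t σ(τ) dτ)·f₁(t) dt. -/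
open MeasureTheory Set

/-- The primitive of a function continuous on `[0,∞)` is differentiable there. -/
lemma hasDerivWithinAt_primitive_Ici {a : ℝ → ℝ} (ha : ContinuousOn a (Ici 0)) {t : ℝ}
    (ht : 0 ≤ t) : HasDerivWithinAt (fun s => ∫ τ in (0 : ℝ)..s, a τ) (a t) (Ici 0) t := by
  have hc : Continuous fun τ => a (max τ 0) :=
    ha.comp_continuous (by fun_prop) fun τ => le_max_right τ 0
  have hd := (hc.integral_hasStrictDerivAt 0 t).hasDerivAt.hasDerivWithinAt (s := Ici 0)
  rw [max_eq_left ht] at hd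
  have heq : ∀ s ∈ Ici (0 : ℝ), (∫ τ in (0 : ℝ)..s, a τ) = ∫ τ in (0 : ℝ)..s, a (max τ 0) := by
    intro s hs
    refine intervalIntegral.integral_congr fun τ hτ => ?_
    rw [uIcc_of_le hs] at hτ
    simp only [max_eq_left hτ.1]
  exact hd.congr heq (heq t ht)

lemma continuousOn_primitive_Ici {a : ℝ → ℝ} (ha : ContinuousOn a (Ici 0)) :
    ContinuousOn (fun s => ∫ τ in (0 : ℝ)..s, a τ) (Ici 0) :=
  fun _ ht => (hasDerivWithinAt_primitive_Ici ha ht).continuousWithinAt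

lemma mul_sub_le_primitive_sub {a : ℝ → ℝ} (ha : ContinuousOn a (Ici 0)) {c : ℝ}
    (hc : ∀ t ≥ (0 : ℝ), c ≤ a t) {s t : ℝ} (hs : 0 ≤ s) (hst : s ≤ t) :
    c * (t - s) ≤ (∫ τ in (0 : ℝ)..t, a τ) - ∫ τ in (0 : ℝ)..s, a τ := by
  have hi : ∀ u v : ℝ, 0 ≤ u → u ≤ v → IntervalIntegrable a volume u v := fun u v hu huv =>
    ContinuousOn.intervalIntegrable_of_Icc huv (ha.mono fun x hx => hu.trans hx.1)
  rw [intervalIntegral.integral_interval_sub_left (hi 0 t le_rfl (hs.trans hst)) (hi 0 s le_rfl hs)]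
  have h := intervalIntegral.integral_mono_on hst (intervalIntegrable_const (c := c))
    (hi s t hs hst) fun x hx => hc x (hs.trans hx.1)
  rw [intervalIntegral.integral_const, smul_eq_mul] at h
  linarith

/-- Variation of constants for the scalar linear equation `x' = a x + f` on `[0,∞)`. -/
lemma exp_neg_primitive_mul_eq {a f x : ℝ → ℝ} (ha : ContinuousOn a (Ici 0))
    (hf : ContinuousOn f (Ici 0))
    (hx : ∀ t ≥ (0 : ℝ), HasDerivWithinAt x (a t * x t + f t) (Ici 0) t) {t : ℝ} (ht : 0 ≤ t) :
    Real.exp (-∫ τ in (0 : ℝ)..t, a τ) * x t =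
      x 0 + ∫ s in (0 : ℝ)..t, Real.exp (-∫ τ in (0 : ℝ)..s, a τ) * f s := by
  have hd : ∀ s ≥ (0 : ℝ), HasDerivWithinAt (fun s => Real.exp (-∫ τ in (0 : ℝ)..s, a τ) * x s)
      (Real.exp (-∫ τ in (0 : ℝ)..s, a τ) * f s) (Ici 0) s := by
    intro s hs
    refine ((hasDerivWithinAt_primitive_Ici ha hs).neg.exp.mul (hx s hs)).congr_deriv ?_
    simp only [Pi.neg_apply]
    ring
  have hsub : Icc 0 t ⊆ Ici (0 : ℝ) := fun s hs => hs.1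
  have h := intervalIntegral.integral_eq_sub_of_hasDeriv_right_of_le ht
    (fun s hs => ((hd s hs.1).continuousWithinAt).mono hsub)
    (fun s hs => (hd s hs.1.le).mono fun u hu => hs.1.le.trans (le_of_lt hu))
    (ContinuousOn.intervalIntegrable_of_Icc ht
      (((continuousOn_primitive_Ici ha).neg.rexp.mul hf).mono hsub))
  simp only [intervalIntegral.integral_same, neg_zero, Real.exp_zero, one_mul] at h
  linarith

/-- Lemma (bounded solutions of the hyperbolic ODE system, characterization):
Let `σ : [0,∞) → ℝ` be continuous with `σ(t) ≥ σ₀ > 0`, and `f₁, f₂` continuous and in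
`L¹ ∩ L^∞` on `[0,∞)`.  If `x₁, x₂` are differentiable on `[0,∞)` and satisfy
`x₁' − σ x₁ = f₁` and `x₂' + σ x₂ = f₂`, then `(x₁, x₂)` is bounded on `[0,∞)` iff
`0 = x₁(0) + ∫₀^∞ exp(−∫₀^t σ) f₁(t) dt`. -/
theorem bounded_solution_iff_orthogonality
    (σ f₁ f₂ x₁ x₂ : ℝ → ℝ) (σ₀ : ℝ) (hσ₀ : 0 < σ₀)
    (hσcont : ContinuousOn σ (Ici 0)) (hσlb : ∀ t ≥ (0 : ℝ), σ₀ ≤ σ t)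
    (hf₁cont : ContinuousOn f₁ (Ici 0)) (hf₂cont : ContinuousOn f₂ (Ici 0))
    (hf₁L1 : IntegrableOn f₁ (Ioi 0)) (hf₂L1 : IntegrableOn f₂ (Ioi 0))
    (hf₁Linf : ∃ M, ∀ t ≥ (0 : ℝ), |f₁ t| ≤ M)
    (hf₂Linf : ∃ M, ∀ t ≥ (0 : ℝ), |f₂ t| ≤ M)
    (hx₁ : ∀ t ≥ (0 : ℝ), HasDerivWithinAt x₁ (σ t * x₁ t + f₁ t) (Ici 0) t)
    (hx₂ : ∀ t ≥ (0 : ℝ), HasDerivWithinAt x₂ (-(σ t * x₂ t) + f₂ t) (Ici 0) t) :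
    (∃ C, ∀ t ≥ (0 : ℝ), |x₁ t| ≤ C ∧ |x₂ t| ≤ C) ↔
      0 = x₁ 0 + ∫ t in Ioi (0 : ℝ), Real.exp (-∫ τ in (0 : ℝ)..t, σ τ) * f₁ t := by
  set S : ℝ → ℝ := fun t => ∫ τ in (0 : ℝ)..t, σ τ with hS
  have hSc : ContinuousOn S (Ici 0) := continuousOn_primitive_Ici hσcont
  have hSgrow : ∀ s t : ℝ, 0 ≤ s → s ≤ t → σ₀ * (t - s) ≤ S t - S s :=
    fun s t hs hst => mul_sub_le_primitive_sub hσcont hσlb hs hst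
  have hSmono : ∀ s t : ℝ, 0 ≤ s → s ≤ t → S s ≤ S t := fun s t hs hst => by
    nlinarith [hSgrow s t hs hst, mul_nonneg hσ₀.le (sub_nonneg.2 hst)]
  have hS0 : S 0 = 0 := intervalIntegral.integral_same
  have hSlb : ∀ t : ℝ, 0 ≤ t → σ₀ * t ≤ S t := fun t ht => by
    simpa [hS0] using hSgrow 0 t le_rfl ht
  have hvar₁ : ∀ t : ℝ, 0 ≤ t → Real.exp (-S t) * x₁ t =
      x₁ 0 + ∫ s in (0 : ℝ)..t, Real.exp (-S s) * f₁ s :=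
    fun t ht => exp_neg_primitive_mul_eq hσcont hf₁cont hx₁ ht
  have hvar₂ : ∀ t : ℝ, 0 ≤ t → Real.exp (S t) * x₂ t =
      x₂ 0 + ∫ s in (0 : ℝ)..t, Real.exp (S s) * f₂ s := fun t ht => by
    simpa using exp_neg_primitive_mul_eq hσcont.neg hf₂cont
      (fun t ht => by simpa using hx₂ t ht) ht
  have hint : IntegrableOn (fun t => Real.exp (-S t) * f₁ t) (Ioi 0) := by
    refine Integrable.mono hf₁L1
      (((hSc.neg.rexp.mul hf₁cont).mono Ioi_subset_Ici_self).aestronglyMeasurable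
        measurableSet_Ioi) ?_
    filter_upwards [ae_restrict_mem measurableSet_Ioi] with t ht
    rw [norm_mul, Real.norm_of_nonneg (Real.exp_pos _).le]
    refine mul_le_of_le_one_left (norm_nonneg _) (Real.exp_le_one_iff.2 ?_)
    linarith [hSmono 0 t le_rfl (le_of_lt ht)]
  constructor
  · rintro ⟨C, hC⟩
    have hlim := (intervalIntegral_tendsto_integral_Ioi 0 hint Filter.tendsto_id).const_add (x₁ 0)
    have hStop : Filter.Tendsto S Filter.atTop Filter.atTop :=
      Filter.tendsto_atTop_mono' _ ((Filter.eventually_ge_atTop 0).mono hSlb)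
        (Filter.tendsto_id.const_mul_atTop hσ₀)
    have hzero : Filter.Tendsto (fun t => Real.exp (-S t) * x₁ t) Filter.atTop (nhds 0) := by
      have hb : Filter.Tendsto (fun t => Real.exp (-S t) * C) Filter.atTop (nhds 0) := by
        simpa using (Real.tendsto_exp_neg_atTop_nhds_zero.comp hStop).mul_const C
      refine squeeze_zero_norm' ?_ hb
      filter_upwards [Filter.eventually_ge_atTop 0] with t ht
      rw [norm_mul, Real.norm_of_nonneg (Real.exp_pos _).le]
      exact mul_le_mul_of_nonneg_left (hC t ht).1 (Real.exp_pos _).le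
    exact tendsto_nhds_unique (hzero.congr' ((Filter.eventually_ge_atTop 0).mono hvar₁)) hlim
  · intro h0
    have hbound₁ : ∀ t ≥ (0 : ℝ), |x₁ t| ≤ ∫ s in Ioi (0 : ℝ), |f₁ s| := by
      intro t ht
      have hsub : Ioi t ⊆ Ioi (0 : ℝ) := Ioi_subset_Ioi ht
      have htail := intervalIntegral.integral_Ioi_sub_Ioi hint ht
      have heq : Real.exp (-S t) * x₁ t = -∫ s in Ioi t, Real.exp (-S s) * f₁ s := by
        linarith [hvar₁ t ht]
      have hle : Real.exp (-S t) * |x₁ t| ≤ Real.exp (-S t) * ∫ s in Ioi t, |f₁ s| := by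
        rw [← abs_of_pos (Real.exp_pos (-S t)), ← abs_mul, abs_of_pos (Real.exp_pos (-S t)), heq,
          abs_neg, ← integral_const_mul, ← Real.norm_eq_abs]
        refine norm_integral_le_of_norm_le ((hf₁L1.mono_set hsub).abs.const_mul _) ?_
        filter_upwards [ae_restrict_mem measurableSet_Ioi] with s hs
        rw [norm_mul, Real.norm_of_nonneg (Real.exp_pos _).le]
        refine mul_le_mul_of_nonneg_right (Real.exp_le_exp.2 ?_) (abs_nonneg _)
        linarith [hSmono t s ht (le_of_lt hs)]
      exact (le_of_mul_le_mul_left hle (Real.exp_pos _)).trans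
        (setIntegral_mono_set hf₁L1.abs (ae_of_all _ fun s => abs_nonneg _) hsub.eventuallyLE)
    have hbound₂ : ∀ t ≥ (0 : ℝ), |x₂ t| ≤ |x₂ 0| + ∫ s in Ioi (0 : ℝ), |f₂ s| := by
      intro t ht
      have hsub : Ioc 0 t ⊆ Ioi (0 : ℝ) := Ioc_subset_Ioi_self
      have hI : |∫ s in (0 : ℝ)..t, Real.exp (S s) * f₂ s| ≤
          Real.exp (S t) * ∫ s in Ioc 0 t, |f₂ s| := by
        rw [intervalIntegral.integral_of_le ht, ← integral_const_mul, ← Real.norm_eq_abs]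
        refine norm_integral_le_of_norm_le ((hf₂L1.mono_set hsub).abs.const_mul _) ?_
        filter_upwards [ae_restrict_mem measurableSet_Ioc] with s hs
        rw [norm_mul, Real.norm_of_nonneg (Real.exp_pos _).le]
        exact mul_le_mul_of_nonneg_right (Real.exp_le_exp.2 (hSmono s t hs.1.le hs.2))
          (abs_nonneg _)
      have hmono : ∫ s in Ioc 0 t, |f₂ s| ≤ ∫ s in Ioi (0 : ℝ), |f₂ s| :=
        setIntegral_mono_set hf₂L1.abs (ae_of_all _ fun s => abs_nonneg _) hsub.eventuallyLE
      have hone : 1 ≤ Real.exp (S t) :=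
        Real.one_le_exp (hS0 ▸ hSmono 0 t le_rfl ht)
      have hle : Real.exp (S t) * |x₂ t| ≤
          Real.exp (S t) * (|x₂ 0| + ∫ s in Ioc 0 t, |f₂ s|) := by
        calc Real.exp (S t) * |x₂ t| = |x₂ 0 + ∫ s in (0 : ℝ)..t, Real.exp (S s) * f₂ s| := by
              rw [← hvar₂ t ht, abs_mul, abs_of_pos (Real.exp_pos _)]
          _ ≤ |x₂ 0| + |∫ s in (0 : ℝ)..t, Real.exp (S s) * f₂ s| := abs_add_le _ _
          _ ≤ Real.exp (S t) * |x₂ 0| + Real.exp (S t) * ∫ s in Ioc 0 t, |f₂ s| :=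
              add_le_add (le_mul_of_one_le_left (abs_nonneg _) hone) hI
          _ = _ := by ring
      exact (le_of_mul_le_mul_left hle (Real.exp_pos _)).trans (by gcongr)
    exact ⟨max _ _, fun t ht =>
      ⟨(hbound₁ t ht).trans (le_max_left _ _), (hbound₂ t ht).trans (le_max_right _ _)⟩⟩
end

section
/- Let φ : ℝ³ → ℝ be a Schwartz function satisfying the semilinear elliptic equation −Δφ + φ = φ³ pointwise on ℝ³. Then there exist constants C₁, C₂ > 0 such that for every multi-index β = (β₁, β₂, β₃), the iterated partial derivative ∂^β φ satisfies ‖∂^β φ‖_{L²(ℝ³)} ≤ C₁ · |β|! · C₂^{|β|}, where |β| = β₁ + β₂ + β₃. -/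
open MeasureTheory

/-- The partial derivative in the `i`-th coordinate direction of a function on `ℝ³`. -/
noncomputable def partialDeriv3 (i : Fin 3) (f : (Fin 3 → ℝ) → ℝ) : (Fin 3 → ℝ) → ℝ :=
  fun x => fderiv ℝ f x (Pi.single i 1)

/-- The iterated partial derivative `∂^β = ∂₁^{β₁} ∂₂^{β₂} ∂₃^{β₃}`. -/
noncomputable def iteratedPartialDeriv3 (β : Fin 3 → ℕ) (f : (Fin 3 → ℝ) → ℝ) :
    (Fin 3 → ℝ) → ℝ :=
  (partialDeriv3 0)^[β 0] ((partialDeriv3 1)^[β 1] ((partialDeriv3 2)^[β 2] f))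

open scoped ENNReal NNReal SchwartzMap FourierTransform LineDeriv Convolution

section SchwartzMul

variable {E : Type*} [NormedAddCommGroup E] [InnerProductSpace ℝ E]

/-- The pointwise product of two complex Schwartz functions. -/
noncomputable def schwartzMul (f g : 𝓢(E, ℂ)) : 𝓢(E, ℂ) :=
  SchwartzMap.pairing (ContinuousLinearMap.mul ℂ ℂ) f g

theorem schwartzMul_apply (f g : 𝓢(E, ℂ)) (x : E) : schwartzMul f g x = f x * g x := rfl

end SchwartzMul

section FourierMoment

variable {E : Type*} [NormedAddCommGroup E] [InnerProductSpace ℝ E] [FiniteDimensional ℝ E]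
  [MeasurableSpace E] [BorelSpace E]

/-- The `k`-th absolute moment `∫ ‖ξ‖ ^ k ‖𝓕⁻ f ξ‖ dξ` of the inverse Fourier transform. -/
noncomputable def fourierMoment (k : ℕ) (f : 𝓢(E, ℂ)) : ℝ≥0∞ :=
  ∫⁻ ξ, ‖ξ‖ₑ ^ k * ‖𝓕⁻ f ξ‖ₑ

theorem fourierInv_schwartzMul (f g : 𝓢(E, ℂ)) (ξ : E) :
    𝓕⁻ (schwartzMul f g) ξ = ∫ t, 𝓕⁻ f t * 𝓕⁻ g (ξ - t) := by
  have h : 𝓕⁻ (schwartzMul f g) =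
      SchwartzMap.convolution (ContinuousLinearMap.mul ℂ ℂ) (𝓕⁻ f) (𝓕⁻ g) := by
    rw [← FourierTransform.fourierInv_fourier_eq (F := 𝓢(E, ℂ))
      (SchwartzMap.convolution (ContinuousLinearMap.mul ℂ ℂ) (𝓕⁻ f) (𝓕⁻ g)),
      SchwartzMap.fourier_convolution]
    simp [schwartzMul]
  rw [h, SchwartzMap.convolution_apply]
  rfl

theorem fourierMoment_lt_top (k : ℕ) (f : 𝓢(E, ℂ)) : fourierMoment k f < ∞ := by
  have h := (SchwartzMap.integrable_pow_mul volume (𝓕⁻ f) k).hasFiniteIntegral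
  simpa [HasFiniteIntegral, fourierMoment, enorm_mul, enorm_pow] using h

theorem fourierMoment_schwartzMul_le (k : ℕ) (f g : 𝓢(E, ℂ)) :
    fourierMoment k (schwartzMul f g) ≤
      ∑ p ∈ Finset.HasAntidiagonal.antidiagonal k, (k.choose p.1 : ℝ≥0∞) * (fourierMoment p.1 f *
        fourierMoment p.2 g) := by
  have hf : Measurable fun t ↦ 𝓕⁻ f t := (𝓕⁻ f).continuous.measurable
  have hg : Measurable fun t ↦ 𝓕⁻ g t := (𝓕⁻ g).continuous.measurable
  have key (ξ t : E) : ‖ξ‖ₑ ^ k * ‖𝓕⁻ f t * 𝓕⁻ g (ξ - t)‖ₑ ≤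
      ∑ p ∈ Finset.HasAntidiagonal.antidiagonal k, (k.choose p.1 : ℝ≥0∞) *
        ((‖t‖ₑ ^ p.1 * ‖𝓕⁻ f t‖ₑ) * (‖ξ - t‖ₑ ^ p.2 * ‖𝓕⁻ g (ξ - t)‖ₑ)) := by
    have h1 : ‖ξ‖ₑ ≤ ‖t‖ₑ + ‖ξ - t‖ₑ := by simpa using enorm_add_le t (ξ - t)
    calc ‖ξ‖ₑ ^ k * ‖𝓕⁻ f t * 𝓕⁻ g (ξ - t)‖ₑ
        ≤ (‖t‖ₑ + ‖ξ - t‖ₑ) ^ k * ‖𝓕⁻ f t * 𝓕⁻ g (ξ - t)‖ₑ := by gcongr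
      _ = _ := by
        rw [Commute.add_pow' (Commute.all _ _), Finset.sum_mul, enorm_mul]
        refine Finset.sum_congr rfl fun p _ ↦ ?_
        rw [nsmul_eq_mul]
        ring
  calc fourierMoment k (schwartzMul f g)
      ≤ ∫⁻ ξ, ∫⁻ t, ∑ p ∈ Finset.HasAntidiagonal.antidiagonal k, (k.choose p.1 : ℝ≥0∞) *
        ((‖t‖ₑ ^ p.1 * ‖𝓕⁻ f t‖ₑ) * (‖ξ - t‖ₑ ^ p.2 * ‖𝓕⁻ g (ξ - t)‖ₑ)) := by
        refine lintegral_mono fun ξ ↦ ?_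
        rw [fourierInv_schwartzMul]
        calc _ ≤ ‖ξ‖ₑ ^ k * ∫⁻ t, ‖𝓕⁻ f t * 𝓕⁻ g (ξ - t)‖ₑ := by
              gcongr
              exact enorm_integral_le_lintegral_enorm _
          _ = ∫⁻ t, ‖ξ‖ₑ ^ k * ‖𝓕⁻ f t * 𝓕⁻ g (ξ - t)‖ₑ := by
              rw [lintegral_const_mul _ (by fun_prop)]
          _ ≤ _ := lintegral_mono fun t ↦ key ξ t
    _ = ∫⁻ t, ∫⁻ ξ, ∑ p ∈ Finset.HasAntidiagonal.antidiagonal k, (k.choose p.1 : ℝ≥0∞) *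
        ((‖t‖ₑ ^ p.1 * ‖𝓕⁻ f t‖ₑ) * (‖ξ - t‖ₑ ^ p.2 * ‖𝓕⁻ g (ξ - t)‖ₑ)) :=
        lintegral_lintegral_swap (by fun_prop)
    _ = ∫⁻ t, ∑ p ∈ Finset.HasAntidiagonal.antidiagonal k, (k.choose p.1 : ℝ≥0∞) *
        ((‖t‖ₑ ^ p.1 * ‖𝓕⁻ f t‖ₑ) * fourierMoment p.2 g) := by
        refine lintegral_congr fun t ↦ ?_
        rw [lintegral_finsetSum _ (by fun_prop)]
        refine Finset.sum_congr rfl fun p _ ↦ ?_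
        rw [lintegral_const_mul _ (by fun_prop), lintegral_const_mul _ (by fun_prop),
          lintegral_sub_right_eq_self (fun ξ ↦ ‖ξ‖ₑ ^ p.2 * ‖𝓕⁻ g ξ‖ₑ) t]
        rfl
    _ = _ := by
        rw [lintegral_finsetSum _ (by fun_prop)]
        refine Finset.sum_congr rfl fun p _ ↦ ?_
        rw [lintegral_const_mul _ (by fun_prop), lintegral_mul_const _ (by fun_prop)]
        rfl

/-- Products of functions with factorially bounded Fourier moments have the same property, with a
loss of `a + 1` factorial shifts. -/
theorem fourierMoment_schwartzMul_le_of_le {f g : 𝓢(E, ℂ)} {A B R : ℝ≥0∞} {a k : ℕ}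
    (hf : ∀ i ≤ k, fourierMoment i f ≤ i.factorial * (A * R ^ i))
    (hg : ∀ j ≤ k, fourierMoment j g ≤ (j + a).factorial * (B * R ^ j)) :
    fourierMoment k (schwartzMul f g) ≤ (k + (a + 1)).factorial * (A * B * R ^ k) := by
  have hterm (p : ℕ × ℕ) (hp : p ∈ Finset.HasAntidiagonal.antidiagonal k) :
      (k.choose p.1 : ℝ≥0∞) * (fourierMoment p.1 f * fourierMoment p.2 g) ≤
        ((k + a).factorial : ℝ≥0∞) * (A * B * R ^ k) := by
    obtain ⟨i, j⟩ := p
    obtain rfl : i + j = k := by simpa using hp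
    have hfac : (i + j).choose i * (i.factorial * (j + a).factorial) ≤ (i + j + a).factorial := by
      have h1 : (i + j + a).choose i * i.factorial * (j + a).factorial = (i + j + a).factorial := by
        have := Nat.choose_mul_factorial_mul_factorial (n := i + j + a) (k := i) (by lia)
        rwa [show i + j + a - i = j + a by lia] at this
      rw [← h1, mul_assoc]
      exact Nat.mul_le_mul_right _ (Nat.choose_le_choose i (by lia))
    calc ((i + j).choose i : ℝ≥0∞) * (fourierMoment i f * fourierMoment j g)
        ≤ ((i + j).choose i : ℝ≥0∞) * ((i.factorial * (A * R ^ i)) *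
          ((j + a).factorial * (B * R ^ j))) := by
          gcongr
          · exact hf i (by lia)
          · exact hg j (by lia)
      _ = (((i + j).choose i * (i.factorial * (j + a).factorial) : ℕ) : ℝ≥0∞) *
          (A * B * R ^ (i + j)) := by push_cast; ring
      _ ≤ _ := by gcongr
  calc fourierMoment k (schwartzMul f g)
      ≤ ∑ p ∈ Finset.HasAntidiagonal.antidiagonal k, ((k + a).factorial : ℝ≥0∞) * (A * B * R ^ k) :=
        (fourierMoment_schwartzMul_le k f g).trans (Finset.sum_le_sum hterm)
    _ = (((k + 1) * (k + a).factorial : ℕ) : ℝ≥0∞) * (A * B * R ^ k) := by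
        simp [mul_assoc]
    _ ≤ _ := by
        gcongr
        rw [← add_assoc, Nat.factorial_succ]
        gcongr
        omega

theorem fourierMoment_le_of_cubic {f : 𝓢(E, ℂ)}
    (h : ∀ ξ, ‖ξ‖ₑ ^ 2 * ‖𝓕⁻ f ξ‖ₑ ≤ ‖𝓕⁻ (schwartzMul f (schwartzMul f f)) ξ‖ₑ) :
    ∃ C : ℝ≥0, ∀ k, fourierMoment k f ≤ k.factorial * (C * C ^ k) := by
  obtain ⟨c, hc⟩ : ∃ c : ℝ≥0, fourierMoment 0 f + fourierMoment 1 f ≤ c :=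
    ⟨_, (ENNReal.coe_toNNReal (ENNReal.add_lt_top.2
      ⟨fourierMoment_lt_top 0 f, fourierMoment_lt_top 1 f⟩).ne).ge⟩
  refine ⟨c + 1, fun k ↦ ?_⟩
  set R : ℝ≥0∞ := ((c + 1 : ℝ≥0) : ℝ≥0∞)
  have hcR : (c : ℝ≥0∞) ≤ R := by simp [R]
  have h1R : 1 ≤ R := by simp [R]
  induction k using Nat.strong_induction_on with
  | _ k ih =>
    match k, ih with
    | 0, _ => simpa using (le_self_add.trans hc).trans hcR
    | 1, _ =>
      calc fourierMoment 1 f ≤ R * 1 := by simpa using (le_add_self.trans hc).trans hcR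
        _ ≤ _ := by simpa using mul_le_mul_right h1R R
    | k + 2, ih =>
      have hf (i : ℕ) (hi : i ≤ k) : fourierMoment i f ≤ i.factorial * (R * R ^ i) :=
        ih i (by lia)
      have hff (j : ℕ) (hj : j ≤ k) :
          fourierMoment j (schwartzMul f f) ≤ (j + 1).factorial * (R * R * R ^ j) :=
        fourierMoment_schwartzMul_le_of_le (a := 0) (fun i hi ↦ hf i (hi.trans hj))
          fun i hi ↦ hf i (hi.trans hj)
      calc fourierMoment (k + 2) f
          ≤ fourierMoment k (schwartzMul f (schwartzMul f f)) := by
            refine lintegral_mono fun ξ ↦ ?_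
            rw [pow_add, mul_assoc]
            gcongr
            exact h ξ
        _ ≤ (k + (1 + 1)).factorial * (R * (R * R) * R ^ k) :=
            fourierMoment_schwartzMul_le_of_le hf hff
        _ = _ := by ring

theorem enorm_fourierInv_lineDerivOp_le {m : E} (hm : ‖m‖ ≤ 1) (f : 𝓢(E, ℂ)) (ξ : E) :
    ‖𝓕⁻ (∂_{m} f) ξ‖ₑ ≤ ((2 * NNReal.pi : ℝ≥0) * ‖ξ‖ₑ) * ‖𝓕⁻ f ξ‖ₑ := by
  have hg : (inner ℝ · m).HasTemperateGrowth := by fun_prop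
  have h : ‖𝓕⁻ (∂_{m} f) ξ‖ = 2 * Real.pi * |inner ℝ ξ m| * ‖𝓕⁻ f ξ‖ := by
    rw [SchwartzMap.fourierInv_lineDerivOp_eq]
    simp [SchwartzMap.smulLeftCLM_apply_apply hg, abs_of_pos Real.pi_pos, mul_assoc]
  have h2 : ‖𝓕⁻ (∂_{m} f) ξ‖₊ ≤ (2 * NNReal.pi) * ‖ξ‖₊ * ‖𝓕⁻ f ξ‖₊ := by
    rw [← NNReal.coe_le_coe]
    push_cast [NNReal.coe_real_pi]
    rw [h]
    gcongr
    exact (abs_real_inner_le_norm ξ m).trans (mul_le_of_le_one_right (norm_nonneg _) hm)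
  simpa [enorm] using ENNReal.coe_le_coe.2 h2

theorem fourierInv_sub_sum_lineDerivOp {ι : Type*} [Fintype ι] (b : OrthonormalBasis ι ℝ E)
    (f : 𝓢(E, ℂ)) (ξ : E) :
    𝓕⁻ (f - ∑ i, ∂_{b i} (∂_{b i} f)) ξ = (1 + (2 * Real.pi * ‖ξ‖) ^ 2 : ℝ) * 𝓕⁻ f ξ := by
  have hg (i : ι) : (inner ℝ · (b i)).HasTemperateGrowth := by fun_prop
  have h (i : ι) : 𝓕⁻ (∂_{b i} (∂_{b i} f)) ξ =
      (-(2 * Real.pi) ^ 2 * (inner ℝ ξ (b i)) ^ 2 : ℝ) * 𝓕⁻ f ξ := by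
    simp only [SchwartzMap.fourierInv_lineDerivOp_eq, smul_apply,
      SchwartzMap.smulLeftCLM_apply_apply (hg i), smul_eq_mul, Complex.real_smul]
    push_cast
    linear_combination (2 * Real.pi) ^ 2 * (inner ℝ ξ (b i) : ℂ) ^ 2 * 𝓕⁻ f ξ * Complex.I_sq
  rw [← FourierTransform.fourierInvCLM_apply (R := ℂ), map_sub, map_sum, sub_apply, sum_apply]
  simp_rw [FourierTransform.fourierInvCLM_apply]
  simp_rw [h]
  rw [← Finset.sum_mul, ← Complex.ofReal_sum, ← Finset.mul_sum, b.sum_sq_inner_left]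
  push_cast
  ring

theorem eLpNorm_fourierInv_eq (f : 𝓢(E, ℂ)) :
    eLpNorm (𝓕⁻ f : 𝓢(E, ℂ)) 2 volume = eLpNorm f 2 volume := by
  have h : ‖f.toLp 2‖ = ‖(𝓕⁻ f : 𝓢(E, ℂ)).toLp 2‖ := by
    simpa using SchwartzMap.norm_fourier_toL2_eq (𝓕⁻ f : 𝓢(E, ℂ))
  rw [SchwartzMap.norm_toLp, SchwartzMap.norm_toLp] at h
  have hf : eLpNorm f 2 volume ≠ ⊤ := (f.memLp 2 volume).eLpNorm_ne_top
  have hg : eLpNorm (𝓕⁻ f : 𝓢(E, ℂ)) 2 volume ≠ ⊤ :=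
    ((𝓕⁻ f : 𝓢(E, ℂ)).memLp 2 volume).eLpNorm_ne_top
  exact ((ENNReal.toReal_eq_toReal_iff' hf hg).1 h).symm

/-- Interpolation of the `L²` norm between the supremum and the `2k`-th moment. -/
theorem eLpNorm_le_of_norm_fourierInv_le {f g : 𝓢(E, ℂ)} {C S b : ℝ≥0} {k : ℕ}
    (hf : fourierMoment (2 * k) f ≤ (2 * k).factorial * (C * C ^ (2 * k)))
    (hS : ∀ ξ, ‖𝓕⁻ f ξ‖ₑ ≤ S)
    (hg : ∀ ξ, ‖𝓕⁻ g ξ‖ₑ ≤ (b * ‖ξ‖ₑ) ^ k * ‖𝓕⁻ f ξ‖ₑ) :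
    eLpNorm g 2 volume ≤ (((S + C) * k.factorial * (2 * b * C) ^ k : ℝ≥0) : ℝ≥0∞) := by
  have hfac : (2 * k).factorial ≤ 2 ^ (2 * k) * (k.factorial * k.factorial) := by
    have := Nat.choose_mul_factorial_mul_factorial (n := 2 * k) (k := k) (by lia)
    rw [show 2 * k - k = k by lia, mul_assoc] at this
    rw [← this]
    gcongr
    exact Nat.choose_le_two_pow _ _
  have hmain : ∫⁻ ξ, ‖𝓕⁻ g ξ‖ₑ ^ 2 ≤
      (((S + C) * k.factorial * (2 * b * C) ^ k : ℝ≥0) : ℝ≥0∞) ^ 2 := by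
    calc ∫⁻ ξ, ‖𝓕⁻ g ξ‖ₑ ^ 2
        ≤ ∫⁻ ξ, (b ^ (2 * k) * S : ℝ≥0∞) * (‖ξ‖ₑ ^ (2 * k) * ‖𝓕⁻ f ξ‖ₑ) := by
          refine lintegral_mono fun ξ ↦ ?_
          calc ‖𝓕⁻ g ξ‖ₑ ^ 2 ≤ ((b * ‖ξ‖ₑ) ^ k * ‖𝓕⁻ f ξ‖ₑ) ^ 2 := by
                gcongr
                exact hg ξ
            _ = (b ^ (2 * k) * ‖𝓕⁻ f ξ‖ₑ) * (‖ξ‖ₑ ^ (2 * k) * ‖𝓕⁻ f ξ‖ₑ) := by ring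
            _ ≤ _ := by
                gcongr
                exact hS ξ
      _ = (b ^ (2 * k) * S : ℝ≥0∞) * fourierMoment (2 * k) f := by
          have : Measurable fun t ↦ 𝓕⁻ f t := (𝓕⁻ f).continuous.measurable
          rw [lintegral_const_mul _ (by fun_prop)]
          rfl
      _ ≤ (b ^ (2 * k) * S : ℝ≥0∞) * ((2 ^ (2 * k) * (k.factorial * k.factorial) : ℕ) *
          (C * C ^ (2 * k))) := by
          gcongr
          refine hf.trans ?_
          gcongr
      _ = ((b ^ (2 * k) * 2 ^ (2 * k) * C ^ (2 * k) * k.factorial ^ 2 * (S * C) : ℝ≥0) : ℝ≥0∞) := by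
          push_cast
          ring
      _ ≤ _ := by
          rw [← ENNReal.coe_pow, ENNReal.coe_le_coe]
          calc b ^ (2 * k) * 2 ^ (2 * k) * C ^ (2 * k) * (k.factorial : ℝ≥0) ^ 2 * (S * C)
              ≤ b ^ (2 * k) * 2 ^ (2 * k) * C ^ (2 * k) * (k.factorial : ℝ≥0) ^ 2 *
                ((S + C) * (S + C)) := by
                gcongr
                · exact le_self_add
                · exact le_add_self
            _ = _ := by ring
  rw [← eLpNorm_fourierInv_eq, eLpNorm_eq_lintegral_rpow_enorm_toReal (by simp) (by simp)]
  calc _ = (∫⁻ ξ, ‖𝓕⁻ g ξ‖ₑ ^ 2) ^ (1 / 2 : ℝ) := by simp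
    _ ≤ ((((S + C) * k.factorial * (2 * b * C) ^ k : ℝ≥0) : ℝ≥0∞) ^ 2) ^ (1 / 2 : ℝ) := by
        gcongr
    _ = _ := by
        rw [← ENNReal.rpow_natCast, ← ENNReal.rpow_mul]
        norm_num

end FourierMoment

/-- Transport of a real Schwartz function on `Fin 3 → ℝ` to a complex one on Euclidean space. -/
noncomputable def toEuclideanComplex (f : 𝓢(Fin 3 → ℝ, ℝ)) : 𝓢(EuclideanSpace ℝ (Fin 3), ℂ) :=
  SchwartzMap.postcompCLM Complex.ofRealCLM
    (SchwartzMap.compCLMOfContinuousLinearEquiv ℝ (EuclideanSpace.equiv (Fin 3) ℝ) f)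

theorem toEuclideanComplex_apply (f : 𝓢(Fin 3 → ℝ, ℝ)) (x : EuclideanSpace ℝ (Fin 3)) :
    toEuclideanComplex f x = (f x.ofLp : ℂ) := rfl

theorem eLpNorm_toEuclideanComplex (f : 𝓢(Fin 3 → ℝ, ℝ)) :
    eLpNorm (toEuclideanComplex f) 2 volume = eLpNorm f 2 volume := by
  rw [← eLpNorm_comp_measurePreserving f.continuous.aestronglyMeasurable
    (PiLp.volume_preserving_ofLp (Fin 3))]
  refine eLpNorm_congr_norm_ae (Filter.Eventually.of_forall fun x ↦ ?_)
  simp [toEuclideanComplex_apply]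

theorem coe_lineDerivOp_single (i : Fin 3) (f : 𝓢(Fin 3 → ℝ, ℝ)) :
    ⇑(∂_{(Pi.single i 1 : Fin 3 → ℝ)} f : 𝓢(Fin 3 → ℝ, ℝ)) = partialDeriv3 i f := rfl

theorem toEuclideanComplex_lineDerivOp (i : Fin 3) (f : 𝓢(Fin 3 → ℝ, ℝ)) :
    toEuclideanComplex (∂_{(Pi.single i 1 : Fin 3 → ℝ)} f) =
      ∂_{EuclideanSpace.basisFun (Fin 3) ℝ i} (toEuclideanComplex f) := by
  ext x
  have h : HasFDerivAt (toEuclideanComplex f) (Complex.ofRealCLM.comp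
      ((fderiv ℝ f x.ofLp).comp
        (EuclideanSpace.equiv (Fin 3) ℝ : EuclideanSpace ℝ (Fin 3) →L[ℝ] (Fin 3 → ℝ)))) x :=
    Complex.ofRealCLM.hasFDerivAt.comp x
      ((f.hasFDerivAt x.ofLp).comp x (EuclideanSpace.equiv (Fin 3) ℝ).hasFDerivAt)
  rw [SchwartzMap.lineDerivOp_apply_eq_fderiv, h.fderiv, toEuclideanComplex_apply,
    SchwartzMap.lineDerivOp_apply_eq_fderiv]
  simp only [ContinuousLinearMap.comp_apply, EuclideanSpace.basisFun_apply]
  rfl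

theorem exists_iterate_partialDeriv3 (i : Fin 3) (n : ℕ) (f : 𝓢(Fin 3 → ℝ, ℝ)) :
    ∃ g : 𝓢(Fin 3 → ℝ, ℝ), ⇑g = (partialDeriv3 i)^[n] f ∧
      ∀ ξ, ‖𝓕⁻ (toEuclideanComplex g) ξ‖ₑ ≤
        ((2 * NNReal.pi : ℝ≥0) * ‖ξ‖ₑ) ^ n * ‖𝓕⁻ (toEuclideanComplex f) ξ‖ₑ := by
  induction n with
  | zero => exact ⟨f, rfl, by simp⟩
  | succ n ih =>
    obtain ⟨g, hg, hle⟩ := ih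
    refine ⟨∂_{(Pi.single i 1 : Fin 3 → ℝ)} g, ?_, fun ξ ↦ ?_⟩
    · rw [coe_lineDerivOp_single, hg, Function.iterate_succ_apply']
    · rw [toEuclideanComplex_lineDerivOp, pow_succ', mul_assoc]
      refine (enorm_fourierInv_lineDerivOp_le ?_ _ ξ).trans ?_
      · simp
      · gcongr
        exact hle ξ

theorem exists_iteratedPartialDeriv3 (β : Fin 3 → ℕ) (f : 𝓢(Fin 3 → ℝ, ℝ)) :
    ∃ g : 𝓢(Fin 3 → ℝ, ℝ), ⇑g = iteratedPartialDeriv3 β f ∧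
      ∀ ξ, ‖𝓕⁻ (toEuclideanComplex g) ξ‖ₑ ≤
        ((2 * NNReal.pi : ℝ≥0) * ‖ξ‖ₑ) ^ (∑ i, β i) * ‖𝓕⁻ (toEuclideanComplex f) ξ‖ₑ := by
  obtain ⟨g₂, hg₂, h₂⟩ := exists_iterate_partialDeriv3 2 (β 2) f
  obtain ⟨g₁, hg₁, h₁⟩ := exists_iterate_partialDeriv3 1 (β 1) g₂
  obtain ⟨g₀, hg₀, h₀⟩ := exists_iterate_partialDeriv3 0 (β 0) g₁
  refine ⟨g₀, by rw [hg₀, hg₁, hg₂, iteratedPartialDeriv3], fun ξ ↦ ?_⟩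
  rw [Fin.sum_univ_three, pow_add, pow_add, mul_assoc, mul_assoc]
  refine (h₀ ξ).trans ?_
  gcongr
  refine (h₁ ξ).trans ?_
  gcongr
  exact h₂ ξ

theorem enorm_fourierInv_toEuclideanComplex_le {φ : 𝓢(Fin 3 → ℝ, ℝ)}
    (hφ : ∀ x, -(∑ i : Fin 3, partialDeriv3 i (partialDeriv3 i ⇑φ) x) + φ x = (φ x) ^ 3)
    (ξ : EuclideanSpace ℝ (Fin 3)) :
    ‖ξ‖ₑ ^ 2 * ‖𝓕⁻ (toEuclideanComplex φ) ξ‖ₑ ≤ ‖𝓕⁻ (schwartzMul (toEuclideanComplex φ)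
      (schwartzMul (toEuclideanComplex φ) (toEuclideanComplex φ))) ξ‖ₑ := by
  set f := toEuclideanComplex φ with hf
  let b := EuclideanSpace.basisFun (Fin 3) ℝ
  have heq : schwartzMul f (schwartzMul f f) = f - ∑ i, ∂_{b i} (∂_{b i} f) := by
    ext x
    simp only [b, hf, ← toEuclideanComplex_lineDerivOp, sub_apply, sum_apply, schwartzMul_apply,
      toEuclideanComplex_apply]
    rw [← Complex.ofReal_sum]
    norm_cast
    have := hφ x.ofLp
    simp only [← coe_lineDerivOp_single] at this
    linarith
  rw [heq, fourierInv_sub_sum_lineDerivOp b]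
  have h : ‖ξ‖ ^ 2 * ‖𝓕⁻ f ξ‖ ≤ ‖((1 + (2 * Real.pi * ‖ξ‖) ^ 2 : ℝ) : ℂ) * 𝓕⁻ f ξ‖ := by
    rw [norm_mul, Complex.norm_real, Real.norm_of_nonneg (by positivity), mul_pow]
    gcongr
    have : 1 ≤ (2 * Real.pi) ^ 2 := one_le_pow₀ (by linarith [Real.pi_gt_three])
    nlinarith [sq_nonneg ‖ξ‖]
  have h' : ‖ξ‖₊ ^ 2 * ‖𝓕⁻ f ξ‖₊ ≤ ‖((1 + (2 * Real.pi * ‖ξ‖) ^ 2 : ℝ) : ℂ) * 𝓕⁻ f ξ‖₊ := h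
  simpa only [enorm, ENNReal.coe_mul, ENNReal.coe_pow] using ENNReal.coe_le_coe.2 h'

/-- Analyticity of the ground state: if a Schwartz function `φ : ℝ³ → ℝ` satisfies
`−Δφ + φ = φ³`, then there are constants `C₁, C₂ > 0` with
`‖∂^β φ‖_{L²} ≤ C₁ |β|! C₂^{|β|}` for every multi-index `β`. -/
theorem ground_state_derivative_bounds (φ : SchwartzMap (Fin 3 → ℝ) ℝ)
    (hφ : ∀ x, -(∑ i : Fin 3, partialDeriv3 i (partialDeriv3 i ⇑φ) x) + φ x = (φ x) ^ 3) :
    ∃ C₁ C₂ : ℝ, 0 < C₁ ∧ 0 < C₂ ∧ ∀ β : Fin 3 → ℕ,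
      eLpNorm (iteratedPartialDeriv3 β ⇑φ) 2 volume ≤
        ENNReal.ofReal (C₁ * (Nat.factorial (∑ i, β i) : ℝ) * C₂ ^ (∑ i, β i)) := by
  obtain ⟨C, hC⟩ := fourierMoment_le_of_cubic (enorm_fourierInv_toEuclideanComplex_le hφ)
  let f := toEuclideanComplex φ
  let S : ℝ≥0 := ⟨SchwartzMap.seminorm ℝ 0 0 (𝓕⁻ f), apply_nonneg _ _⟩
  have hS (ξ : EuclideanSpace ℝ (Fin 3)) : ‖𝓕⁻ f ξ‖ₑ ≤ S :=
    ENNReal.coe_le_coe.2 (SchwartzMap.norm_le_seminorm ℝ (𝓕⁻ f) ξ)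
  refine ⟨(S + (C + 1) : ℝ≥0), (2 * (2 * NNReal.pi) * (C + 1) : ℝ≥0), by positivity, ?_,
    fun β ↦ ?_⟩
  · exact_mod_cast (by positivity : 0 < 2 * (2 * Real.pi) * ((C : ℝ) + 1))
  obtain ⟨g, hg, hle⟩ := exists_iteratedPartialDeriv3 β φ
  rw [← hg, ← eLpNorm_toEuclideanComplex]
  refine (eLpNorm_le_of_norm_fourierInv_le (C := C + 1) ((hC _).trans ?_) hS hle).trans_eq ?_
  · gcongr <;> exact le_self_add
  · rw [← ENNReal.ofReal_coe_nnreal]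
    push_cast
    rfl
end

section
/- For every natural number n, one has ∑_{k=0}^{n} 1/((k²+1)·((n−k)²+1)) < 6/(n²+1). -/
/-- Partial fraction decomposition, summed using the symmetry `k ↦ n - k`. -/
theorem sum_inv_sq_add_one_convolution_eq (n : ℕ) (hn : n ≠ 0) :
    ∑ k ∈ Finset.range (n + 1),
        (1 : ℝ) / (((k : ℝ) ^ 2 + 1) * (((n - k : ℕ) : ℝ) ^ 2 + 1))
      = (2 * n * ∑ k ∈ Finset.range (n + 1), (1 : ℝ) / ((k : ℝ) ^ 2 + 1)
          + 4 * ∑ k ∈ Finset.range (n + 1), (k : ℝ) / ((k : ℝ) ^ 2 + 1))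
        / (n * ((n : ℝ) ^ 2 + 4)) := by
  have hn' : (n : ℝ) ≠ 0 := by exact_mod_cast hn
  let g : ℕ → ℝ := fun k => (2 * (k : ℝ) + n) / ((k : ℝ) ^ 2 + 1)
  have hterm : ∀ k ∈ Finset.range (n + 1),
      (1 : ℝ) / (((k : ℝ) ^ 2 + 1) * (((n - k : ℕ) : ℝ) ^ 2 + 1))
        = (g k + g (n - k)) / (n * ((n : ℝ) ^ 2 + 4)) := by
    intro k hk
    have hkn : k ≤ n := Nat.lt_succ_iff.mp (Finset.mem_range.mp hk)
    have h₁ : (k : ℝ) ^ 2 + 1 ≠ 0 := by positivity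
    have h₂ : ((n : ℝ) - k) ^ 2 + 1 ≠ 0 := by positivity
    have h₃ : (n : ℝ) ^ 2 + 4 ≠ 0 := by positivity
    simp only [g, Nat.cast_sub hkn]
    field_simp
    ring
  have hg : ∑ k ∈ Finset.range (n + 1), g k
      = n * ∑ k ∈ Finset.range (n + 1), (1 : ℝ) / ((k : ℝ) ^ 2 + 1)
          + 2 * ∑ k ∈ Finset.range (n + 1), (k : ℝ) / ((k : ℝ) ^ 2 + 1) := by
    rw [Finset.mul_sum, Finset.mul_sum, ← Finset.sum_add_distrib]
    refine Finset.sum_congr rfl fun k _ => ?_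
    simp only [g]
    ring
  rw [Finset.sum_congr rfl hterm, ← Finset.sum_div, Finset.sum_add_distrib,
    Finset.sum_flip, hg]
  ring

theorem sum_inv_sq_add_one_le {n : ℕ} (hn : 2 ≤ n) :
    ∑ k ∈ Finset.range (n + 1), (1 : ℝ) / ((k : ℝ) ^ 2 + 1) ≤ (21 / 10 - 2 / (2 * n + 1) : ℝ) := by
  induction n, hn using Nat.le_induction with
  | base => norm_num [Finset.sum_range_succ]
  | succ m hm ih =>
    rw [Finset.sum_range_succ]
    have h : 1 / (((m + 1 : ℕ) : ℝ) ^ 2 + 1)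
        ≤ 2 / (2 * (m : ℝ) + 1) - 2 / (2 * ((m + 1 : ℕ) : ℝ) + 1) := by
      push_cast
      rw [div_sub_div _ _ (by positivity) (by positivity),
        div_le_div_iff₀ (by positivity) (by positivity)]
      nlinarith
    linarith

theorem sum_div_sq_add_one_le {n : ℕ} (hn : 2 ≤ n) :
    ∑ k ∈ Finset.range (n + 1), (k : ℝ) / ((k : ℝ) ^ 2 + 1) ≤ (3 / 10 * (n + 1) : ℝ) := by
  induction n, hn using Nat.le_induction with
  | base => norm_num [Finset.sum_range_succ]
  | succ m hm ih =>
    rw [Finset.sum_range_succ]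
    have hm' : (2 : ℝ) ≤ m := by exact_mod_cast hm
    have h : ((m + 1 : ℕ) : ℝ) / (((m + 1 : ℕ) : ℝ) ^ 2 + 1) ≤ 3 / 10 := by
      push_cast
      rw [div_le_div_iff₀ (by positivity) (by positivity)]
      nlinarith
    push_cast at h ⊢
    linarith

theorem sum_inv_sq_add_one_convolution_lt (n : ℕ) :
    ∑ k ∈ Finset.range (n + 1),
        (1 : ℝ) / (((k : ℝ) ^ 2 + 1) * (((n - k : ℕ) : ℝ) ^ 2 + 1))
      < 6 / ((n : ℝ) ^ 2 + 1) := by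
  rcases Nat.lt_or_ge n 2 with hn | hn
  · interval_cases n <;> norm_num [Finset.sum_range_succ]
  · have hn' : (2 : ℝ) ≤ n := by exact_mod_cast hn
    have hS : ∑ k ∈ Finset.range (n + 1), (1 : ℝ) / ((k : ℝ) ^ 2 + 1) ≤ 21 / 10 :=
      (sum_inv_sq_add_one_le hn).trans (sub_le_self _ (by positivity))
    have hT := sum_div_sq_add_one_le hn
    rw [sum_inv_sq_add_one_convolution_eq n (by lia)]
    calc _ ≤ 6 * (n : ℝ) / (n * ((n : ℝ) ^ 2 + 4)) := by
          gcongr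
          nlinarith
      _ = 6 / ((n : ℝ) ^ 2 + 4) := by field_simp
      _ < 6 / ((n : ℝ) ^ 2 + 1) := by
          gcongr
          norm_num
end

section
/- For every j ≥ 1 and every natural number n, ∑ over all j-tuples (n₁, …, n_j) of natural numbers with n₁ + ⋯ + n_j = n of the product ∏_{i=1}^{j} 1/(nᵢ²+1) is at most 6^{j−1}/(n²+1). -/
open Finset.HasAntidiagonal (antidiagonal mem_antidiagonal)

theorem sum_antidiagonalTuple_succ {M : Type*} [AddCommMonoid M] (k n : ℕ)
    (F : (Fin (k + 1) → ℕ) → M) :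
    ∑ v ∈ Finset.Nat.antidiagonalTuple (k + 1) n, F v =
      ∑ p ∈ antidiagonal n, ∑ v ∈ Finset.Nat.antidiagonalTuple k p.2, F (Fin.cons p.1 v) := by
  rw [Finset.sum_sigma']
  refine Finset.sum_bij' (fun v _ => ⟨(v 0, n - v 0), Fin.tail v⟩)
    (fun x _ => Fin.cons x.1.1 x.2) ?_ ?_ ?_ ?_ ?_
  · intro v hv
    rw [Finset.Nat.mem_antidiagonalTuple, Fin.sum_univ_succ] at hv
    simp only [Finset.mem_sigma, mem_antidiagonal, Finset.Nat.mem_antidiagonalTuple,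
      Fin.tail]
    omega
  · rintro ⟨⟨a, b⟩, v⟩ hx
    simp only [Finset.mem_sigma, mem_antidiagonal,
      Finset.Nat.mem_antidiagonalTuple] at hx
    simp [Finset.Nat.mem_antidiagonalTuple, Fin.sum_univ_succ, hx.2, hx.1]
  · intro v _
    simp
  · rintro ⟨⟨a, b⟩, v⟩ hx
    simp only [Finset.mem_sigma, mem_antidiagonal] at hx
    obtain rfl : b = n - a := by omega
    simp
  · intro v _
    simp

theorem sum_antidiagonal_add {M : Type*} [AddCommMonoid M] (n : ℕ) (f : ℕ → M) :
    ∑ p ∈ antidiagonal n, (f p.1 + f p.2) = 2 • ∑ k ∈ Finset.range (n + 1), f k := by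
  have h : ∑ p ∈ antidiagonal n, f p.1 = ∑ k ∈ Finset.range (n + 1), f k :=
    Finset.Nat.sum_antidiagonal_eq_sum_range_succ (fun a _ => f a) n
  rw [Finset.sum_add_distrib, ← Finset.Nat.sum_antidiagonal_swap (f := fun p => f p.2)]
  simp only [Prod.snd_swap, h, two_nsmul]

theorem sum_range_inv_sq_add_one_le (n : ℕ) :
    ∑ k ∈ Finset.range (n + 3), (1 : ℝ) / ((k : ℝ) ^ 2 + 1) ≤ 21 / 10 - 1 / ((n : ℝ) + 5 / 2) := by
  induction n with
  | zero => norm_num [Finset.sum_range_succ]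
  | succ n ih =>
    rw [show n + 1 + 3 = n + 3 + 1 from rfl, Finset.sum_range_succ]
    have h : (1 : ℝ) / (((n + 3 : ℕ) : ℝ) ^ 2 + 1) ≤
        1 / (n + 5 / 2) - 1 / (((n + 1 : ℕ) : ℝ) + 5 / 2) := by
      push_cast
      rw [div_sub_div _ _ (by positivity) (by positivity),
        div_le_div_iff₀ (by positivity) (by positivity)]
      nlinarith
    linarith

theorem sum_range_inv_le (n : ℕ) (hn : 6 ≤ n) :
    ∑ k ∈ Finset.range (n + 1), (1 : ℝ) / (k : ℝ) ≤ 9 / 20 * n := by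
  induction n, hn using Nat.le_induction with
  | base => norm_num [Finset.sum_range_succ]
  | succ n hn ih =>
    rw [Finset.sum_range_succ]
    have hn' : (6 : ℝ) ≤ n := by exact_mod_cast hn
    have h : (1 : ℝ) / ((n + 1 : ℕ) : ℝ) ≤ 9 / 20 := by
      push_cast
      rw [div_le_div_iff₀ (by positivity) (by positivity)]
      linarith
    push_cast at *
    linarith

theorem div_sq_add_one_le_one_div {x : ℝ} (hx : 0 ≤ x) : x / (x ^ 2 + 1) ≤ 1 / x := by
  rcases hx.eq_or_lt with rfl | hx
  · simp
  · rw [div_le_div_iff₀ (by positivity) hx]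
    nlinarith

theorem one_div_mul_one_div_le {x y : ℝ} (hx : 0 ≤ x) (hy : 0 ≤ y) :
    1 / x * (1 / y) ≤ 1 / (x + y) * (1 / x + 1 / y) := by
  rcases hx.eq_or_lt with rfl | hx
  · simp; positivity
  rcases hy.eq_or_lt with rfl | hy
  · simp; positivity
  · apply le_of_eq
    field_simp
    ring

theorem sq_add_one_mul_inv_mul_inv_le {x y : ℝ} (hx : 0 ≤ x) (hy : 0 ≤ y) :
    ((x + y) ^ 2 + 1) * (1 / (x ^ 2 + 1) * (1 / (y ^ 2 + 1))) ≤
      (1 / (x ^ 2 + 1) + 1 / (y ^ 2 + 1)) + 2 / (x + y) * (1 / x + 1 / y) := by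
  have h₁ : x / (x ^ 2 + 1) * (y / (y ^ 2 + 1)) ≤ 1 / (x + y) * (1 / x + 1 / y) :=
    (mul_le_mul (div_sq_add_one_le_one_div hx) (div_sq_add_one_le_one_div hy)
      (by positivity) (by positivity)).trans (one_div_mul_one_div_le hx hy)
  have h₂ : ((x + y) ^ 2 + 1) * (1 / (x ^ 2 + 1) * (1 / (y ^ 2 + 1))) =
      (1 / (x ^ 2 + 1) + 1 / (y ^ 2 + 1)) + 2 * (x / (x ^ 2 + 1) * (y / (y ^ 2 + 1)))
        - 1 / (x ^ 2 + 1) * (1 / (y ^ 2 + 1)) := by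
    field_simp
    ring
  have h₃ : 0 ≤ 1 / (x ^ 2 + 1) * (1 / (y ^ 2 + 1)) := by positivity
  have h₄ : 2 / (x + y) * (1 / x + 1 / y) = 2 * (1 / (x + y) * (1 / x + 1 / y)) := by ring
  linarith

theorem sum_antidiagonal_inv_sq_add_one_le (n : ℕ) :
    ∑ p ∈ antidiagonal n, (1 : ℝ) / ((p.1 : ℝ) ^ 2 + 1) * (1 / ((p.2 : ℝ) ^ 2 + 1))
      ≤ 6 / ((n : ℝ) ^ 2 + 1) := by
  rcases lt_or_ge n 6 with hn | hn
  · interval_cases n <;>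
      norm_num [Finset.Nat.sum_antidiagonal_eq_sum_range_succ_mk, Finset.sum_range_succ]
  rw [le_div_iff₀' (by positivity), Finset.mul_sum]
  have hn' : (0 : ℝ) < n := by exact_mod_cast (by omega : 0 < n)
  have hsq : ∑ k ∈ Finset.range (n + 1), (1 : ℝ) / ((k : ℝ) ^ 2 + 1) ≤ 21 / 10 := by
    obtain ⟨m, rfl⟩ : ∃ m, n = m + 2 := ⟨n - 2, by omega⟩
    refine (sum_range_inv_sq_add_one_le m).trans (sub_le_self _ (by positivity))
  have hharm : 2 / (n : ℝ) * (2 * ∑ k ∈ Finset.range (n + 1), (1 : ℝ) / (k : ℝ)) ≤ 9 / 5 := by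
    rw [div_mul_eq_mul_div, div_le_iff₀ hn']
    linarith [sum_range_inv_le n hn]
  calc _ ≤ ∑ p ∈ antidiagonal n, (((1 : ℝ) / ((p.1 : ℝ) ^ 2 + 1) + 1 / ((p.2 : ℝ) ^ 2 + 1))
          + 2 / (n : ℝ) * (1 / (p.1 : ℝ) + 1 / (p.2 : ℝ))) := by
        refine Finset.sum_le_sum fun p hp => ?_
        rw [← mem_antidiagonal.mp hp, Nat.cast_add]
        exact sq_add_one_mul_inv_mul_inv_le p.1.cast_nonneg p.2.cast_nonneg
    _ = 2 * ∑ k ∈ Finset.range (n + 1), (1 : ℝ) / ((k : ℝ) ^ 2 + 1)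
          + 2 / (n : ℝ) * (2 * ∑ k ∈ Finset.range (n + 1), (1 : ℝ) / (k : ℝ)) := by
        rw [Finset.sum_add_distrib, ← Finset.mul_sum,
          sum_antidiagonal_add n fun k => (1 : ℝ) / ((k : ℝ) ^ 2 + 1),
          sum_antidiagonal_add n fun k => (1 : ℝ) / (k : ℝ), nsmul_eq_mul, nsmul_eq_mul,
          Nat.cast_ofNat]
    _ ≤ 6 := by linarith

theorem sum_antidiagonalTuple_prod_inv_sq_add_one_le (j n : ℕ) (hj : 1 ≤ j) :
    ∑ v ∈ Finset.Nat.antidiagonalTuple j n, ∏ i : Fin j, (1 : ℝ) / ((v i : ℝ) ^ 2 + 1)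
      ≤ 6 ^ (j - 1) / ((n : ℝ) ^ 2 + 1) := by
  induction j, hj using Nat.le_induction generalizing n with
  | base => simp
  | succ j hj ih =>
    simp only [sum_antidiagonalTuple_succ, Fin.prod_univ_succ, Fin.cons_zero, Fin.cons_succ,
      ← Finset.mul_sum]
    calc _ ≤ ∑ p ∈ antidiagonal n,
            (1 : ℝ) / ((p.1 : ℝ) ^ 2 + 1) * (6 ^ (j - 1) / ((p.2 : ℝ) ^ 2 + 1)) :=
          Finset.sum_le_sum fun p _ => mul_le_mul_of_nonneg_left (ih p.2) (by positivity)
      _ = 6 ^ (j - 1) * ∑ p ∈ antidiagonal n,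
            (1 : ℝ) / ((p.1 : ℝ) ^ 2 + 1) * (1 / ((p.2 : ℝ) ^ 2 + 1)) := by
          rw [Finset.mul_sum]
          exact Finset.sum_congr rfl fun p _ => by ring
      _ ≤ 6 ^ (j - 1) * (6 / ((n : ℝ) ^ 2 + 1)) :=
          mul_le_mul_of_nonneg_left (sum_antidiagonal_inv_sq_add_one_le n) (by positivity)
      _ = 6 ^ (j + 1 - 1) / ((n : ℝ) ^ 2 + 1) := by
          rw [← mul_div_assoc, ← pow_succ, Nat.sub_add_cancel hj, Nat.add_sub_cancel]
end

section
/- Let H be a complex Hilbert space and let P, Q : H → H be bounded linear operators which are idempotent (P ∘ P = P and Q ∘ Q = Q, not necessarily self-adjoint) and satisfy ‖P − Q‖ < 1 in operator norm. Then the operator U := Q ∘ P + (I − Q) ∘ (I − P) is invertible in the algebra of bounded operators on H, and U ∘ P = Q ∘ U (equivalently, U P U⁻¹ = Q). -/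
section IdempotentPair

variable {R : Type*} [Ring R] {p q : R}

theorem IsIdempotentElem.intertwine_mul_intertwine
    (hp : IsIdempotentElem p) (hq : IsIdempotentElem q) :
    (p * q + (1 - p) * (1 - q)) * (q * p + (1 - q) * (1 - p)) = 1 - (p - q) ^ 2 := by
  have hq' : ∀ x, q * (q * x) = q * x := fun x => by rw [← mul_assoc, hq.eq]
  simp only [sq, mul_add, add_mul, mul_sub, sub_mul, mul_one, one_mul, mul_assoc,
    hp.eq, hq.eq, hq']
  abel

theorem IsIdempotentElem.intertwine_mul
    (hp : IsIdempotentElem p) (hq : IsIdempotentElem q) :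
    (q * p + (1 - q) * (1 - p)) * p = q * (q * p + (1 - q) * (1 - p)) := by
  rw [add_mul, mul_add, mul_assoc, mul_assoc, hp.eq, hp.one_sub_mul_self, ← mul_assoc q q,
    hq.eq, ← mul_assoc q (1 - q), hq.mul_one_sub_self, mul_zero, zero_mul]

theorem IsIdempotentElem.isUnit_intertwine
    (hp : IsIdempotentElem p) (hq : IsIdempotentElem q) (h : IsUnit (1 - (p - q) ^ 2)) :
    IsUnit (q * p + (1 - q) * (1 - p)) := by
  have hvu := hp.intertwine_mul_intertwine hq
  have huv := hq.intertwine_mul_intertwine hp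
  rw [← neg_sub p q, neg_sq, ← hvu] at huv
  rw [← hvu] at h
  exact ((show Commute _ _ from huv.symm).isUnit_mul_iff.mp h).2

end IdempotentPair

/-- Kato's theorem on pairs of projections: if `P, Q` are bounded idempotents on a complex
Hilbert space with `‖P − Q‖ < 1`, then `U = QP + (I − Q)(I − P)` is invertible and
intertwines `P` and `Q`, i.e. `U P = Q U`. -/
theorem kato_pair_of_projections {H : Type*} [NormedAddCommGroup H]
    [InnerProductSpace ℂ H] [CompleteSpace H]
    (P Q : H →L[ℂ] H) (hP : P ∘L P = P) (hQ : Q ∘L Q = Q) (hPQ : ‖P - Q‖ < 1) :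
    IsUnit (Q ∘L P + (1 - Q) ∘L (1 - P)) ∧
      (Q ∘L P + (1 - Q) ∘L (1 - P)) ∘L P = Q ∘L (Q ∘L P + (1 - Q) ∘L (1 - P)) := by
  have hP' : IsIdempotentElem P := hP
  have hQ' : IsIdempotentElem Q := hQ
  refine ⟨hP'.isUnit_intertwine hQ' (isUnit_one_sub_of_norm_lt_one ?_), hP'.intertwine_mul hQ'⟩
  exact (norm_pow_le' _ two_pos).trans_lt (pow_lt_one₀ (norm_nonneg _) hPQ two_ne_zero)
end

section
/- Let d ≥ 1, let 1 ≤ p < ∞ and 1 ≤ q < ∞, and let μ be Lebesgue measure on ℝ^d. Suppose (α_k)_{k∈ℤ} are nonnegative reals with ∑_{k∈ℤ} α_k^q < ∞, and (a_k)_{k∈ℤ} are measurable functions ℝ^d → ℂ with pairwise disjoint supports such that μ(supp a_k) ≤ 2^k and |a_k(x)| ≤ 2^{−k/p} for almost every x. Let f = ∑_{k∈ℤ} α_k a_k (well defined pointwise, since the supports are pairwise disjoint). Then ∫₀^∞ (t^{1/p} f*(t))^q dt/t ≤ (2^{2q/p}/(2^{q/p} − 1)) · ∑_{k∈ℤ}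 α_k^q. -/
open MeasureTheory
open scoped ENNReal

/-- The decreasing rearrangement `f*(t) = inf {σ ≥ 0 : μ{|f| > σ} ≤ t}` of a function
`f : ℝ^d → ℂ`, with values in `[0,∞]`. -/
noncomputable def decRearrangement (d : ℕ) (f : (Fin d → ℝ) → ℂ) (t : ℝ) : ℝ≥0∞ :=
  sInf {σ : ℝ≥0∞ | volume {x | σ < (‖f x‖₊ : ℝ≥0∞)} ≤ ENNReal.ofReal t}

/-- The `q`-th power of the Lorentz `L^{p,q}` quasinorm:
`∫₀^∞ (t^{1/p} f*(t))^q dt/t`. -/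
noncomputable def lorentzNormPow (d : ℕ) (p q : ℝ) (f : (Fin d → ℝ) → ℂ) : ℝ≥0∞ :=
  ∫⁻ t in Set.Ioi (0 : ℝ),
    (ENNReal.ofReal (t ^ (1 / p)) * decRearrangement d f t) ^ q / ENNReal.ofReal t

/-- The sum of the geometric progression `2 ^ i` over the integers `i < j` is `2 ^ j`. -/
theorem tsum_two_zpow_sub (j : ℤ) : ∑' n : ℕ, (2 : ℝ≥0∞) ^ (j - 1 - (n : ℤ)) = 2 ^ j := by
  have h : ∀ n : ℕ, (2 : ℝ≥0∞) ^ (j - 1 - (n : ℤ)) = 2 ^ (j - 1) * (2⁻¹ : ℝ≥0∞) ^ n := by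
    intro n
    rw [sub_eq_add_neg, ENNReal.zpow_add two_ne_zero ENNReal.ofNat_ne_top, ENNReal.zpow_neg,
      zpow_natCast, ENNReal.inv_pow]
  simp_rw [h]
  rw [ENNReal.tsum_mul_left, ENNReal.tsum_geometric, ENNReal.one_sub_inv_two, inv_inv]
  nth_rewrite 2 [← zpow_one (2 : ℝ≥0∞)]
  rw [← ENNReal.zpow_add two_ne_zero ENNReal.ofNat_ne_top, sub_add_cancel]

theorem decRearrangement_le {d : ℕ} {f : (Fin d → ℝ) → ℂ} {t : ℝ} {σ : ℝ≥0∞}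
    (h : volume {x | σ < (‖f x‖₊ : ℝ≥0∞)} ≤ ENNReal.ofReal t) : decRearrangement d f t ≤ σ :=
  sInf_le h

/-- If the functions `a k` are disjointly supported, then a combination of them exceeds a common
bound for the terms of index `k ≥ j` only on the supports of the `a k` with `k < j`. -/
theorem volume_lt_nnnorm_tsum_le {d : ℕ} {c : ℤ → ℂ} {a : ℤ → (Fin d → ℝ) → ℂ}
    (hdisj : Pairwise fun k l => Disjoint (Function.support (a k)) (Function.support (a l)))
    (hsupp : ∀ k, volume (Function.support (a k)) ≤ 2 ^ k) {j : ℤ} {σ : ℝ≥0∞}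
    (hσ : ∀ k, j ≤ k → ∀ᵐ x ∂volume, (‖c k * a k x‖₊ : ℝ≥0∞) ≤ σ) :
    volume {x | σ < (‖∑' k : ℤ, c k * a k x‖₊ : ℝ≥0∞)} ≤ 2 ^ j := by
  have hae : ∀ᵐ x ∂volume, ∀ k, j ≤ k → (‖c k * a k x‖₊ : ℝ≥0∞) ≤ σ := by
    rw [ae_all_iff]
    intro k
    by_cases hk : j ≤ k
    · filter_upwards [hσ k hk] with x hx _ using hx
    · exact .of_forall fun x h => absurd h hk
  have hsub : {x | σ < (‖∑' k : ℤ, c k * a k x‖₊ : ℝ≥0∞)} ≤ᵐ[volume]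
      ⋃ n : ℕ, Function.support (a (j - 1 - n)) := by
    filter_upwards [hae] with x hx (hlt : σ < (‖∑' k : ℤ, c k * a k x‖₊ : ℝ≥0∞))
    obtain ⟨k, hk⟩ : ∃ k, a k x ≠ 0 := by
      by_contra! h
      simp [h] at hlt
    have hsum : ∑' l : ℤ, c l * a l x = c k * a k x := by
      refine tsum_eq_single k fun l hl => ?_
      have : x ∉ Function.support (a l) := Set.disjoint_right.mp (hdisj hl) hk
      rw [Function.notMem_support.mp this, mul_zero]
    rw [hsum] at hlt
    have hkj : k < j := by
      by_contra! h
      exact (hx k h).not_gt hlt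
    refine Set.mem_iUnion.mpr ⟨(j - 1 - k).toNat, ?_⟩
    rw [Int.toNat_of_nonneg (by lia), sub_sub_cancel]
    exact hk
  calc volume {x | σ < (‖∑' k : ℤ, c k * a k x‖₊ : ℝ≥0∞)}
      ≤ volume (⋃ n : ℕ, Function.support (a (j - 1 - n))) := measure_mono_ae hsub
    _ ≤ ∑' n : ℕ, volume (Function.support (a (j - 1 - n))) := measure_iUnion_le _
    _ ≤ ∑' n : ℕ, (2 : ℝ≥0∞) ^ (j - 1 - (n : ℤ)) := ENNReal.tsum_le_tsum fun n => hsupp _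
    _ = 2 ^ j := tsum_two_zpow_sub j

theorem ofReal_two_zpow (j : ℤ) : ENNReal.ofReal ((2 : ℝ) ^ j) = 2 ^ j := by
  rw [← Real.rpow_intCast, ← ENNReal.ofReal_rpow_of_pos two_pos, ENNReal.ofReal_ofNat,
    ENNReal.rpow_intCast]

/-- A weighted integral over `(0, ∞)` is bounded by a dyadic sum. -/
theorem lorentzNormPow_le_tsum {d : ℕ} {p q : ℝ} (hp : 0 < p) (hq : 0 < q)
    {f : (Fin d → ℝ) → ℂ} {S : ℤ → ℝ≥0∞}
    (hS : ∀ j : ℤ, ∀ t : ℝ, (2 : ℝ) ^ j ≤ t → decRearrangement d f t ^ q ≤ S j) :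
    lorentzNormPow d p q f ≤
      ∑' j : ℤ, ENNReal.ofReal ((2 : ℝ) ^ (((j : ℝ) + 1) * (q / p))) * S j := by
  have hcover : Set.Ioi (0 : ℝ) ⊆ ⋃ j : ℤ, Set.Ico ((2 : ℝ) ^ j) (2 ^ (j + 1)) := by
    intro t ht
    obtain ⟨j, hj⟩ := exists_mem_Ico_zpow (show 0 < t from ht) one_lt_two
    exact Set.mem_iUnion.mpr ⟨j, hj⟩
  refine (lintegral_mono_set hcover).trans ((lintegral_iUnion_le _ _).trans ?_)
  refine ENNReal.tsum_le_tsum fun j => ?_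
  have hj : (0 : ℝ) < 2 ^ j := zpow_pos two_pos j
  have hvol : volume (Set.Ico ((2 : ℝ) ^ j) (2 ^ (j + 1))) = ENNReal.ofReal (2 ^ j) := by
    rw [Real.volume_Ico, zpow_add_one₀ two_ne_zero]
    ring_nf
  have hpt : ∀ t ∈ Set.Ico ((2 : ℝ) ^ j) (2 ^ (j + 1)),
      (ENNReal.ofReal (t ^ (1 / p)) * decRearrangement d f t) ^ q / ENNReal.ofReal t ≤
        ENNReal.ofReal ((2 : ℝ) ^ (((j : ℝ) + 1) * (q / p))) * S j / ENNReal.ofReal (2 ^ j) := by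
    rintro t ⟨h1, h2⟩
    have ht : 0 < t := hj.trans_le h1
    rw [ENNReal.mul_rpow_of_nonneg _ _ hq.le, ENNReal.ofReal_rpow_of_nonneg (by positivity) hq.le,
      ← Real.rpow_mul ht.le, one_div_mul_eq_div]
    gcongr
    · calc t ^ (q / p) ≤ ((2 : ℝ) ^ (j + 1)) ^ (q / p) := by gcongr
        _ = (2 : ℝ) ^ (((j : ℝ) + 1) * (q / p)) := by
          rw [← Real.rpow_intCast, ← Real.rpow_mul zero_le_two]
          push_cast
          rfl
    · exact hS j t h1
  calc _ ≤ ∫⁻ _ in Set.Ico ((2 : ℝ) ^ j) (2 ^ (j + 1)),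
        ENNReal.ofReal ((2 : ℝ) ^ (((j : ℝ) + 1) * (q / p))) * S j / ENNReal.ofReal (2 ^ j) :=
        setLIntegral_mono' measurableSet_Ico hpt
    _ = _ := by
      rw [setLIntegral_const, hvol,
        ENNReal.div_mul_cancel (ENNReal.ofReal_pos.mpr hj).ne' ENNReal.ofReal_ne_top]

/-- A discrete Hardy-type identity. -/
theorem tsum_dyadic_tail {r : ℝ} (hr : 0 < r) {γ : ℤ → ℝ} (hγ : ∀ k, 0 ≤ γ k)
    (hsum : Summable γ) :
    ∑' j : ℤ, ENNReal.ofReal ((2 : ℝ) ^ (((j : ℝ) + 1) * r)) *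
        ∑' n : ℕ, ENNReal.ofReal (γ (j + n) * (2 : ℝ) ^ (-((j + n : ℤ) : ℝ) * r)) =
      ENNReal.ofReal ((2 : ℝ) ^ (2 * r) / ((2 : ℝ) ^ r - 1) * ∑' k, γ k) := by
  have h2 : 1 < (2 : ℝ) ^ r := Real.one_lt_rpow one_lt_two hr
  have hterm : ∀ (j : ℤ) (n : ℕ), ENNReal.ofReal ((2 : ℝ) ^ (((j : ℝ) + 1) * r)) *
      ENNReal.ofReal (γ (j + n) * (2 : ℝ) ^ (-((j + n : ℤ) : ℝ) * r)) =
      ENNReal.ofReal ((2 : ℝ) ^ r * ((2 : ℝ) ^ r)⁻¹ ^ n) * ENNReal.ofReal (γ (j + n)) := by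
    intro j n
    rw [← ENNReal.ofReal_mul (by positivity), ← ENNReal.ofReal_mul (by positivity)]
    congr 1
    have : (2 : ℝ) ^ (((j : ℝ) + 1) * r) * (2 : ℝ) ^ (-((j + n : ℤ) : ℝ) * r) =
        (2 : ℝ) ^ r * ((2 : ℝ) ^ r)⁻¹ ^ n := by
      rw [← Real.rpow_neg zero_le_two, ← Real.rpow_natCast, ← Real.rpow_mul zero_le_two,
        ← Real.rpow_add two_pos, ← Real.rpow_add two_pos]
      push_cast
      ring_nf
    rw [← this]
    ring
  have hgeom : HasSum (fun n : ℕ => (2 : ℝ) ^ r * ((2 : ℝ) ^ r)⁻¹ ^ n)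
      ((2 : ℝ) ^ (2 * r) / ((2 : ℝ) ^ r - 1)) := by
    have h := (hasSum_geometric_of_lt_one (r := ((2 : ℝ) ^ r)⁻¹) (by positivity)
      (inv_lt_one_of_one_lt₀ h2)).mul_left ((2 : ℝ) ^ r)
    have hval : (2 : ℝ) ^ r * (1 - ((2 : ℝ) ^ r)⁻¹)⁻¹ = (2 : ℝ) ^ (2 * r) / ((2 : ℝ) ^ r - 1) := by
      have h3 : (2 : ℝ) ^ r - 1 ≠ 0 := by linarith
      rw [two_mul, Real.rpow_add two_pos]
      field_simp
    rwa [hval] at h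
  have hshift : ∀ n : ℕ, ∑' j : ℤ, ENNReal.ofReal (γ (j + n)) = ENNReal.ofReal (∑' k, γ k) := by
    intro n
    rw [ENNReal.ofReal_tsum_of_nonneg hγ hsum]
    exact (Equiv.addRight (n : ℤ)).tsum_eq fun k => ENNReal.ofReal (γ k)
  simp_rw [← ENNReal.tsum_mul_left, hterm]
  rw [ENNReal.tsum_comm]
  simp_rw [ENNReal.tsum_mul_left, hshift]
  rw [ENNReal.tsum_mul_right, ← ENNReal.ofReal_tsum_of_nonneg (fun n => by positivity)
    hgeom.summable, hgeom.tsum_eq, ENNReal.ofReal_mul (div_nonneg (by positivity) (by linarith))]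

/-- Upper bound in the atomic decomposition of Lorentz spaces: a combination
`f = ∑ α_k a_k` of disjointly supported `L^p` atoms with `μ(supp a_k) ≤ 2^k` and
`|a_k| ≤ 2^{−k/p}` satisfies
`∫₀^∞ (t^{1/p} f*(t))^q dt/t ≤ (2^{2q/p}/(2^{q/p} − 1)) ∑ α_k^q`. -/
theorem lorentz_norm_of_atomic_sum (d : ℕ) (hd : 1 ≤ d) (p q : ℝ) (hp : 1 ≤ p) (hq : 1 ≤ q)
    (α : ℤ → ℝ) (hα : ∀ k, 0 ≤ α k) (hαsum : Summable fun k => α k ^ q)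
    (a : ℤ → (Fin d → ℝ) → ℂ) (hmeas : ∀ k, Measurable (a k))
    (hdisj : Pairwise fun k l => Disjoint (Function.support (a k)) (Function.support (a l)))
    (hsupp : ∀ k, volume (Function.support (a k)) ≤ 2 ^ k)
    (hbound : ∀ k, ∀ᵐ x ∂volume, ‖a k x‖ ≤ (2 : ℝ) ^ (-(k : ℝ) / p)) :
    lorentzNormPow d p q (fun x => ∑' k : ℤ, (α k : ℂ) * a k x) ≤
      ENNReal.ofReal
        (((2 : ℝ) ^ (2 * q / p) / ((2 : ℝ) ^ (q / p) - 1)) * ∑' k : ℤ, α k ^ q) := by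
  have hp0 : 0 < p := one_pos.trans_le hp
  have hq0 : 0 < q := one_pos.trans_le hq
  set S : ℤ → ℝ≥0∞ := fun j =>
    ∑' n : ℕ, ENNReal.ofReal (α (j + n) ^ q * (2 : ℝ) ^ (-((j + n : ℤ) : ℝ) * (q / p))) with hS
  have hatom : ∀ j k : ℤ, j ≤ k → ∀ᵐ x ∂volume, (‖(α k : ℂ) * a k x‖₊ : ℝ≥0∞) ≤ S j ^ q⁻¹ := by
    intro j k hjk
    filter_upwards [hbound k] with x hx
    rw [ENNReal.le_rpow_inv_iff hq0]
    have hnorm : ‖(α k : ℂ) * a k x‖ ≤ α k * (2 : ℝ) ^ (-(k : ℝ) / p) := by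
      rw [norm_mul, Complex.norm_real, Real.norm_of_nonneg (hα k)]
      exact mul_le_mul_of_nonneg_left hx (hα k)
    calc (‖(α k : ℂ) * a k x‖₊ : ℝ≥0∞) ^ q
        = ENNReal.ofReal (‖(α k : ℂ) * a k x‖ ^ q) := by
          rw [← ENNReal.ofReal_rpow_of_nonneg (norm_nonneg _) hq0.le, ofReal_norm, enorm_eq_nnnorm]
      _ ≤ ENNReal.ofReal (α k ^ q * (2 : ℝ) ^ (-(k : ℝ) * (q / p))) := by
          refine ENNReal.ofReal_le_ofReal ((Real.rpow_le_rpow (norm_nonneg _) hnorm hq0.le).trans ?_)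
          rw [Real.mul_rpow (hα k) (by positivity), ← Real.rpow_mul zero_le_two,
            div_mul_eq_mul_div, mul_div_assoc]
      _ ≤ S j := by
          have hk : j + ((k - j).toNat : ℤ) = k := by lia
          have := ENNReal.le_tsum (f := fun n : ℕ => ENNReal.ofReal
            (α (j + n) ^ q * (2 : ℝ) ^ (-((j + n : ℤ) : ℝ) * (q / p)))) (k - j).toNat
          simpa only [hk] using this
  calc _ ≤ ∑' j : ℤ, ENNReal.ofReal ((2 : ℝ) ^ (((j : ℝ) + 1) * (q / p))) * S j := by
        refine lorentzNormPow_le_tsum hp0 hq0 fun j t ht => ?_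
        rw [← ENNReal.le_rpow_inv_iff hq0]
        refine decRearrangement_le ((volume_lt_nnnorm_tsum_le hdisj hsupp (hatom j)).trans ?_)
        rw [← ofReal_two_zpow]
        exact ENNReal.ofReal_le_ofReal ht
    _ = _ := by
        rw [tsum_dyadic_tail (div_pos hq0 hp0) (fun k => Real.rpow_nonneg (hα k) q) hαsum,
          mul_div_assoc]
end

section
/- Let d ≥ 1, let 1 ≤ p < ∞ and 1 ≤ q < ∞, and let μ be Lebesgue measure on ℝ^d. There is a constant C = C(p, q) > 0 with the following property: for every measurable f : ℝ^d → ℂ with ‖f‖_{L^{p,q}} := (∫₀^∞ (t^{1/p} f*(t))^q dt/t)^{1/q} < ∞, there exist nonnegative reals (α_k)_{k∈ℤ} and measurable functions (a_k)_{k∈ℤ} with pairwise disjoint supports, μ(supp a_k) ≤ 2^{k+1}, and |a_k(x)| ≤ 2^{−k/p} almost everywhere, such that f = ∑_{k∈ℤ} α_k a_k almost everywhere and (∑_{k∈ℤ} α_k^q)^{1/q} ≤ C · ‖f‖_{L^{p,q}}. -/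
open MeasureTheory
open scoped ENNReal

/-- The infimum defining the decreasing rearrangement is attained. -/
lemma volume_decRearrangement_lt_le (d : ℕ) (f : (Fin d → ℝ) → ℂ) (t : ℝ) :
    volume {x | decRearrangement d f t < (‖f x‖₊ : ℝ≥0∞)} ≤ ENNReal.ofReal t := by
  have hne : {σ : ℝ≥0∞ | volume {x | σ < (‖f x‖₊ : ℝ≥0∞)} ≤ ENNReal.ofReal t}.Nonempty :=
    ⟨⊤, by simp⟩
  obtain ⟨u, hu_anti, hu_lim, hu_mem⟩ := exists_seq_tendsto_sInf hne (OrderBot.bddBelow _)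
  have hset : {x | decRearrangement d f t < (‖f x‖₊ : ℝ≥0∞)} ⊆
      ⋃ n, {x | u n < (‖f x‖₊ : ℝ≥0∞)} := by
    intro x hx
    obtain ⟨n, hn⟩ := (hu_lim.eventually_lt_const hx).exists
    exact Set.mem_iUnion.2 ⟨n, hn⟩
  have hmono : Monotone fun n => {x | u n < (‖f x‖₊ : ℝ≥0∞)} :=
    fun m n hmn x hx => (hu_anti hmn).trans_lt hx
  calc _ ≤ volume (⋃ n, {x | u n < (‖f x‖₊ : ℝ≥0∞)}) := measure_mono hset
    _ = ⨆ n, volume {x | u n < (‖f x‖₊ : ℝ≥0∞)} := hmono.measure_iUnion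
    _ ≤ _ := iSup_le hu_mem

lemma decRearrangement_antitone (d : ℕ) (f : (Fin d → ℝ) → ℂ) :
    Antitone (decRearrangement d f) := fun _ _ hst =>
  sInf_le_sInf fun _ hσ => le_trans hσ (ENNReal.ofReal_le_ofReal hst)

/-- The dyadic sum `∑ₖ (2^{k/p} f*(2^k))^q` is controlled by the Lorentz quasinorm. -/
lemma tsum_dyadic_decRearrangement_le (d : ℕ) {p q : ℝ} (hp : 0 < p) (hq : 0 ≤ q)
    (f : (Fin d → ℝ) → ℂ) :
    ∑' k : ℤ, (ENNReal.ofReal ((2 : ℝ) ^ ((k : ℝ) / p)) * decRearrangement d f (2 ^ k)) ^ q ≤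
      ENNReal.ofReal (2 * 2 ^ (q / p)) * lorentzNormPow d p q f := by
  set I : ℤ → Set ℝ := fun k => Set.Ioc ((2 : ℝ) ^ k) (2 ^ (k + 1))
  set g : ℝ → ℝ≥0∞ := fun t =>
    (ENNReal.ofReal (t ^ (1 / p)) * decRearrangement d f t) ^ q / ENNReal.ofReal t
  have hdisj : Pairwise (Function.onFun Disjoint I) :=
    (zpow_right_mono₀ (one_le_two (α := ℝ))).pairwise_disjoint_on_Ioc_succ
  have hsub : (⋃ k, I k) ⊆ Set.Ioi (0 : ℝ) :=
    Set.iUnion_subset fun k t ht => lt_trans (by positivity) ht.1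
  have hint : ∑' k, ∫⁻ t in I k, g t ≤ lorentzNormPow d p q f := by
    rw [← lintegral_iUnion (fun k => measurableSet_Ioc) hdisj]
    exact lintegral_mono_set hsub
  rw [← (Equiv.addRight (1 : ℤ)).tsum_eq]
  refine le_trans ?_ (mul_le_mul_right hint _)
  rw [← ENNReal.tsum_mul_left]
  refine ENNReal.tsum_le_tsum fun k => ?_
  simp only [Equiv.coe_addRight]
  set F := decRearrangement d f (2 ^ (k + 1))
  have h2k : (0 : ℝ) < 2 ^ k := by positivity
  have hvol : volume (I k) = ENNReal.ofReal (2 ^ k) := by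
    rw [Real.volume_Ioc, zpow_add_one₀ two_ne_zero]
    congr 1
    ring
  have hlow : (ENNReal.ofReal ((2 ^ k : ℝ) ^ (1 / p)) * F) ^ q /
      ENNReal.ofReal (2 ^ (k + 1)) * ENNReal.ofReal (2 ^ k) ≤ ∫⁻ t in I k, g t := by
    rw [← hvol, ← setLIntegral_const]
    refine setLIntegral_mono' measurableSet_Ioc fun t ht => ?_
    refine ENNReal.div_le_div (ENNReal.rpow_le_rpow (mul_le_mul' ?_ ?_) hq) ?_
    · exact ENNReal.ofReal_le_ofReal
        (Real.rpow_le_rpow h2k.le ht.1.le (by positivity))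
    · exact decRearrangement_antitone d f ht.2
    · exact ENNReal.ofReal_le_ofReal ht.2
  refine le_trans (le_of_eq ?_) (mul_le_mul_right hlow _)
  rw [ENNReal.mul_rpow_of_nonneg _ _ hq, ENNReal.mul_rpow_of_nonneg _ _ hq,
    ENNReal.ofReal_rpow_of_nonneg (by positivity) hq,
    ENNReal.ofReal_rpow_of_nonneg (by positivity) hq, ENNReal.div_eq_inv_mul,
    ← ENNReal.ofReal_inv_of_pos (by positivity)]
  have hreal : ((2 : ℝ) ^ (((k + 1 : ℤ) : ℝ) / p)) ^ q =
      2 * 2 ^ (q / p) * ((((2 : ℝ) ^ k) ^ (1 / p)) ^ q * (((2 : ℝ) ^ (k + 1))⁻¹ * 2 ^ k)) := by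
    have h1 : ((2 : ℝ) ^ (k + 1))⁻¹ * 2 ^ k = 2⁻¹ := by
      rw [zpow_add_one₀ two_ne_zero]
      field_simp
    have h2 : ((2 : ℝ) ^ (((k + 1 : ℤ) : ℝ) / p)) ^ q =
        2 ^ (q / p) * (((2 : ℝ) ^ k) ^ (1 / p)) ^ q := by
      rw [← Real.rpow_intCast, ← Real.rpow_mul zero_le_two, ← Real.rpow_mul zero_le_two,
        ← Real.rpow_mul zero_le_two, ← Real.rpow_add two_pos]
      congr 1
      push_cast
      ring
    rw [h1, h2]
    ring
  rw [hreal, ENNReal.ofReal_mul (by positivity), ENNReal.ofReal_mul (by positivity),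
    ENNReal.ofReal_mul (by positivity), ENNReal.ofReal_mul (p := ((2 : ℝ) ^ (k + 1))⁻¹)
      (by positivity)]
  ring

/-- Existence half of the atomic decomposition of Lorentz spaces: every `f ∈ L^{p,q}(ℝ^d)`
can be written as `f = ∑_{k∈ℤ} α_k a_k` with disjointly supported atoms `a_k`,
`μ(supp a_k) ≤ 2^{k+1}`, `|a_k| ≤ 2^{−k/p}` a.e., and `(∑ α_k^q)^{1/q} ≤ C ‖f‖_{L^{p,q}}`. -/
theorem exists_atomic_decomposition (d : ℕ) (hd : 1 ≤ d) (p q : ℝ) (hp : 1 ≤ p)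
    (hq : 1 ≤ q) :
    ∃ C : ℝ, 0 < C ∧ ∀ f : (Fin d → ℝ) → ℂ, Measurable f →
      lorentzNormPow d p q f < ⊤ →
      ∃ (α : ℤ → ℝ) (a : ℤ → (Fin d → ℝ) → ℂ),
        (∀ k, 0 ≤ α k) ∧
        Summable (fun k => α k ^ q) ∧
        (∀ k, Measurable (a k)) ∧
        (Pairwise fun k l => Disjoint (Function.support (a k)) (Function.support (a l))) ∧
        (∀ k, volume (Function.support (a k)) ≤ 2 ^ (k + 1)) ∧
        (∀ k, ∀ᵐ x ∂volume, ‖a k x‖ ≤ (2 : ℝ) ^ (-(k : ℝ) / p)) ∧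
        (∀ᵐ x ∂volume, f x = ∑' k : ℤ, (α k : ℂ) * a k x) ∧
        ENNReal.ofReal ((∑' k : ℤ, α k ^ q) ^ (1 / q)) ≤
          ENNReal.ofReal C * (lorentzNormPow d p q f) ^ (1 / q) := by
  have hp0 : 0 < p := by linarith
  have hq0 : 0 < q := by linarith
  refine ⟨(2 * 2 ^ (q / p)) ^ (1 / q), by positivity, fun f hf hN => ?_⟩
  set F : ℤ → ℝ≥0∞ := fun k => decRearrangement d f (2 ^ k)
  set A : ℤ → ℝ≥0∞ := fun k => ENNReal.ofReal ((2 : ℝ) ^ ((k : ℝ) / p)) * F k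
  set E : ℤ → Set (Fin d → ℝ) := fun k =>
    {x | F (k + 1) < (‖f x‖₊ : ℝ≥0∞)} ∩ {x | (‖f x‖₊ : ℝ≥0∞) ≤ F k}
  have hsum : ∑' k, A k ^ q ≤ ENNReal.ofReal (2 * 2 ^ (q / p)) * lorentzNormPow d p q f :=
    tsum_dyadic_decRearrangement_le d hp0 hq0.le f
  have htop : ∑' k, A k ^ q ≠ ⊤ :=
    (hsum.trans_lt (ENNReal.mul_lt_top ENNReal.ofReal_lt_top hN)).ne
  have hAtop (k : ℤ) : A k ≠ ⊤ := fun h =>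
    ENNReal.ne_top_of_tsum_ne_top htop k (by rw [h, ENNReal.top_rpow_of_pos hq0])
  have hFtop (k : ℤ) : F k ≠ ⊤ := fun h => hAtop k <| by
    simp only [A, h]
    exact ENNReal.mul_top (ENNReal.ofReal_pos.2 (by positivity)).ne'
  have hFanti : Antitone F := fun k l hkl =>
    decRearrangement_antitone d f (zpow_le_zpow_right₀ one_le_two hkl)
  have hEmeas (k : ℤ) : MeasurableSet (E k) :=
    (measurableSet_lt measurable_const hf.nnnorm.coe_nnreal_ennreal).inter
      (measurableSet_le hf.nnnorm.coe_nnreal_ennreal measurable_const)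
  have hEvol (k : ℤ) : volume (E k) ≤ 2 ^ (k + 1) := by
    refine (measure_mono Set.inter_subset_left).trans
      ((volume_decRearrangement_lt_le d f (2 ^ (k + 1))).trans_eq ?_)
    have h : (2 : ℝ) ^ (k + 1) = ((2 ^ (k + 1) : NNReal) : ℝ) := by simp
    rw [h, ENNReal.ofReal_coe_nnreal, ENNReal.coe_zpow two_ne_zero, ENNReal.coe_ofNat]
  have hElt {k l : ℤ} (hkl : k < l) : Disjoint (E k) (E l) :=
    Set.disjoint_left.2 fun x hk hl =>
      (hk.1.trans_le (hl.2.trans (hFanti (Int.add_one_le_of_lt hkl)))).false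
  have hEdisj {k l : ℤ} (hkl : k ≠ l) : Disjoint (E k) (E l) :=
    hkl.lt_or_gt.elim hElt fun h => (hElt h).symm
  have hαq (k : ℤ) : (A k).toReal ^ q = (A k ^ q).toReal := ENNReal.toReal_rpow _ _
  have hαeq (k : ℤ) : (A k).toReal = (2 : ℝ) ^ ((k : ℝ) / p) * (F k).toReal := by
    rw [ENNReal.toReal_mul, ENNReal.toReal_ofReal (by positivity)]
  have hEnorm {k : ℤ} {x : Fin d → ℝ} (hx : x ∈ E k) :
      0 < ‖f x‖ ∧ ‖f x‖ ≤ (F k).toReal := by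
    refine ⟨?_, ?_⟩
    · have h : (0 : ℝ≥0∞) < ‖f x‖₊ := zero_le.trans_lt hx.1
      simpa using h
    · have h := ENNReal.toReal_mono (hFtop k) hx.2
      simpa using h
  have hαpos {k : ℤ} {x : Fin d → ℝ} (hx : x ∈ E k) : 0 < (A k).toReal := by
    rw [hαeq]
    exact mul_pos (by positivity) ((hEnorm hx).1.trans_le (hEnorm hx).2)
  refine ⟨fun k => (A k).toReal, fun k => (E k).indicator fun x => f x / ((A k).toReal : ℂ),
    fun k => ENNReal.toReal_nonneg, ?_, fun k => (hf.div_const _).indicator (hEmeas k),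
    fun k l hkl => (hEdisj hkl).mono Set.support_indicator_subset Set.support_indicator_subset,
    fun k => (measure_mono Set.support_indicator_subset).trans (hEvol k),
    fun k => Filter.Eventually.of_forall fun x => ?_, ?_, ?_⟩
  · simp only [hαq]
    exact ENNReal.summable_toReal htop
  · beta_reduce
    by_cases hx : x ∈ E k
    · rw [Set.indicator_of_mem hx, norm_div, Complex.norm_real, Real.norm_of_nonneg
        ENNReal.toReal_nonneg, div_le_iff₀ (hαpos hx), hαeq, ← mul_assoc,
        ← Real.rpow_add two_pos, neg_div, neg_add_cancel, Real.rpow_zero, one_mul]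
      exact (hEnorm hx).2
    · rw [Set.indicator_of_notMem hx, norm_zero]
      positivity
  · have hnull : ∀ᵐ x ∂(volume : Measure (Fin d → ℝ)), ∃ k, (‖f x‖₊ : ℝ≥0∞) ≤ F k := by
      rw [ae_iff]
      push Not
      refine le_antisymm (ge_of_tendsto' (x := Filter.atTop)
        (f := fun n : ℕ => ENNReal.ofReal ((2⁻¹ : ℝ) ^ n)) ?_ fun n => ?_) zero_le
      · have h := ENNReal.tendsto_ofReal
          (tendsto_pow_atTop_nhds_zero_of_lt_one (r := (2⁻¹ : ℝ)) (by norm_num) (by norm_num))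
        simpa using h
      · refine (measure_mono fun x hx => ?_).trans
          (volume_decRearrangement_lt_le d f ((2⁻¹ : ℝ) ^ n))
        have h := hx (-(n : ℤ))
        simpa only [F, zpow_neg, zpow_natCast, inv_pow, Set.mem_ofPred_eq] using h
    filter_upwards [hnull] with x hx
    by_cases hfx : f x = 0
    · simp [hfx, Set.indicator]
    have hbdd : ∃ b : ℤ, ∀ k, (‖f x‖₊ : ℝ≥0∞) ≤ F k → k ≤ b := by
      have hfin := ENNReal.finite_const_le_of_tsum_ne_top htop
        (ε := (‖f x‖₊ : ℝ≥0∞) ^ q) (by simp [hfx])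
      obtain ⟨b, hb⟩ := hfin.bddAbove
      refine ⟨max b 0, fun k hk => ?_⟩
      rcases le_total k 0 with h0 | h0
      · exact h0.trans (le_max_right _ _)
      · refine (hb ?_).trans (le_max_left _ _)
        refine ENNReal.rpow_le_rpow (hk.trans (le_mul_of_one_le_left zero_le ?_)) hq0.le
        rw [ENNReal.one_le_ofReal]
        exact Real.one_le_rpow one_le_two (div_nonneg (Int.cast_nonneg h0) hp0.le)
    obtain ⟨k, hk, hmax⟩ := Int.exists_greatest_of_bdd hbdd hx
    have hxE : x ∈ E k := ⟨lt_of_not_ge fun h => absurd (hmax (k + 1) h) (by omega), hk⟩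
    rw [tsum_eq_single k fun l hl => ?_]
    · have h : ((A k).toReal : ℂ) ≠ 0 := Complex.ofReal_ne_zero.2 (hαpos hxE).ne'
      rw [Set.indicator_of_mem hxE, mul_div_cancel₀ _ h]
    · rw [Set.indicator_of_notMem (Set.disjoint_left.1 (hEdisj hl.symm) hxE), mul_zero]
  · simp only [hαq]
    rw [← ENNReal.tsum_toReal_eq (ENNReal.ne_top_of_tsum_ne_top htop), ENNReal.toReal_rpow,
      ENNReal.ofReal_toReal (ENNReal.rpow_ne_top_of_nonneg (by positivity) htop),
      ← ENNReal.ofReal_rpow_of_nonneg (by positivity) (by positivity),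
      ← ENNReal.mul_rpow_of_nonneg _ _ (by positivity)]
    exact ENNReal.rpow_le_rpow hsum (by positivity)
end

section
/- Let φ : ℝ³ → ℝ be a positive Schwartz function satisfying −Δφ + φ = φ³ pointwise on ℝ³. Define, for Schwartz ψ : ℝ³ → ℂ, the mass M[ψ] = ∫_{ℝ³} |ψ(x)|² dx, the energy E[ψ] = ∫_{ℝ³} (½|∇ψ(x)|² − ¼|ψ(x)|⁴) dx, the momentum P[ψ] = ∫_{ℝ³} Im(conj(ψ(x)) ∇ψ(x)) dx ∈ ℝ³, and F[ψ] = M[ψ]·E[ψ] − 2|P[ψ]|². Then the first differential of F at φ vanishes: for every Schwartz function h : ℝ³ → ℂ, lim_{ε→0, ε∈ℝ} (F[φ + εh] − F[φ])/ε = 0. -/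
open MeasureTheory

/-- The partial derivative in the `i`-th coordinate direction of a complex-valued
function on `ℝ³`. -/
noncomputable def cPartialDeriv (i : Fin 3) (ψ : (Fin 3 → ℝ) → ℂ) (x : Fin 3 → ℝ) : ℂ :=
  fderiv ℝ ψ x (Pi.single i 1)

/-- The partial derivative in the `i`-th coordinate direction of a real-valued
function on `ℝ³`. -/
noncomputable def rPartialDeriv (i : Fin 3) (f : (Fin 3 → ℝ) → ℝ) (x : Fin 3 → ℝ) : ℝ :=
  fderiv ℝ f x (Pi.single i 1)

/-- The mass `M[ψ] = ∫ |ψ|²`. -/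
noncomputable def massNLS (ψ : (Fin 3 → ℝ) → ℂ) : ℝ := ∫ x, ‖ψ x‖ ^ 2

/-- The energy `E[ψ] = ∫ (½|∇ψ|² − ¼|ψ|⁴)`. -/
noncomputable def energyNLS (ψ : (Fin 3 → ℝ) → ℂ) : ℝ :=
  ∫ x, ((1 / 2) * ∑ i : Fin 3, ‖cPartialDeriv i ψ x‖ ^ 2 - (1 / 4) * ‖ψ x‖ ^ 4)

/-- The momentum `P[ψ] = ∫ Im(conj(ψ) ∇ψ) ∈ ℝ³` (componentwise). -/
noncomputable def momentumNLS (ψ : (Fin 3 → ℝ) → ℂ) (i : Fin 3) : ℝ :=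
  ∫ x, ((starRingEnd ℂ) (ψ x) * cPartialDeriv i ψ x).im

/-- The functional `F[ψ] = M[ψ]·E[ψ] − 2|P[ψ]|²`. -/
noncomputable def funcF (ψ : (Fin 3 → ℝ) → ℂ) : ℝ :=
  massNLS ψ * energyNLS ψ - 2 * ∑ i : Fin 3, (momentumNLS ψ i) ^ 2

open SchwartzMap LineDeriv

namespace SchwartzMap

section RealAlgebra

variable {D : Type*} [NormedAddCommGroup D] [NormedSpace ℝ D]

/-- The pointwise product of two real-valued Schwartz functions. -/
noncomputable def mulReal (f g : 𝓢(D, ℝ)) : 𝓢(D, ℝ) :=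
  pairing (ContinuousLinearMap.mul ℝ ℝ) f g

@[simp]
theorem mulReal_apply (f g : 𝓢(D, ℝ)) (x : D) : mulReal f g x = f x * g x := rfl

theorem mulReal_coe (f g : 𝓢(D, ℝ)) : ⇑(mulReal f g) = fun x => f x * g x := rfl

theorem lineDerivOp_mulReal (v : D) (f g : 𝓢(D, ℝ)) (x : D) :
    ∂_{v} (mulReal f g) x = ∂_{v} f x * g x + f x * ∂_{v} g x := by
  have hd := (f.hasFDerivAt x).mul (g.hasFDerivAt x)
  have hf : fderiv ℝ (⇑(mulReal f g)) x = _ := hd.fderiv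
  simp only [lineDerivOp_apply_eq_fderiv, hf]
  simp
  ring

/-- Mixed directional derivatives of a Schwartz function commute. -/
theorem lineDerivOp_swap (v w : D) (f : 𝓢(D, ℝ)) (x : D) :
    ∂_{v} (∂_{w} f) x = ∂_{w} (∂_{v} f) x := by
  have hdiff : DifferentiableAt ℝ (fderiv ℝ f) x :=
    ((f.smooth 2).fderiv_right (m := 1) (by norm_num)).differentiable (by norm_num) x
  have key (a b : D) : ∂_{a} (∂_{b} f) x = fderiv ℝ (fderiv ℝ f) x a b := by
    have : fderiv ℝ (fun y => fderiv ℝ f y b) x a = fderiv ℝ (fderiv ℝ f) x a b := by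
      rw [fderiv_clm_apply hdiff (differentiableAt_const b)]
      simp
    exact this
  rw [key, key]
  exact ((f.smooth 2).contDiffAt.isSymmSndFDerivAt (by simp)) v w

end RealAlgebra

section Coordinates

/-- Multiplication of a Schwartz function on `ℝ³` by the `j`-th coordinate. -/
noncomputable def coordMul (j : Fin 3) (f : 𝓢(Fin 3 → ℝ, ℝ)) : 𝓢(Fin 3 → ℝ, ℝ) :=
  smulLeftCLM ℝ (fun x : Fin 3 → ℝ => x j) f

@[simp]
theorem coordMul_apply (j : Fin 3) (f : 𝓢(Fin 3 → ℝ, ℝ)) (x : Fin 3 → ℝ) :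
    coordMul j f x = x j * f x := by
  have hg : (fun x : Fin 3 → ℝ => x j).HasTemperateGrowth :=
    (ContinuousLinearMap.proj (R := ℝ) (φ := fun _ : Fin 3 => ℝ) j).hasTemperateGrowth
  simp [coordMul, hg]

theorem lineDerivOp_coordMul (v : Fin 3 → ℝ) (j : Fin 3) (f : 𝓢(Fin 3 → ℝ, ℝ))
    (x : Fin 3 → ℝ) : ∂_{v} (coordMul j f) x = v j * f x + x j * ∂_{v} f x := by
  have hd := ((ContinuousLinearMap.proj (R := ℝ) (φ := fun _ : Fin 3 => ℝ) j).hasFDerivAt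
    (x := x)).mul (f.hasFDerivAt x)
  have hcoe : ⇑(coordMul j f)
      = ⇑(ContinuousLinearMap.proj (R := ℝ) (φ := fun _ : Fin 3 => ℝ) j) * ⇑f :=
    funext (coordMul_apply j f)
  rw [lineDerivOp_apply_eq_fderiv, lineDerivOp_apply_eq_fderiv, hcoe, hd.fderiv]
  simp
  ring

/-- `∫ f xⱼ ∂ⱼf = -½ ∫ f²`. -/
theorem integral_mul_coord_mul_lineDerivOp (j : Fin 3) (f : 𝓢(Fin 3 → ℝ, ℝ)) :
    ∫ x, f x * (x j * ∂_{(Pi.single j 1 : Fin 3 → ℝ)} f x) = -(1 / 2) * ∫ x, f x ^ 2 := by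
  have hibp := integral_mul_lineDerivOp_right_eq_neg_left (μ := volume) (coordMul j f) f
    (Pi.single j 1 : Fin 3 → ℝ)
  have hsplit : ∫ x, ∂_{(Pi.single j 1 : Fin 3 → ℝ)} (coordMul j f) x * f x
      = (∫ x, f x ^ 2) + ∫ x, f x * (x j * ∂_{(Pi.single j 1 : Fin 3 → ℝ)} f x) := by
    rw [← integral_add]
    · congr 1 with x
      rw [lineDerivOp_coordMul]
      simp
      ring
    · simpa only [pow_two, mulReal_coe] using (mulReal f f).integrable (μ := volume)
    · simpa only [mulReal_coe, coordMul_apply] using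
        (mulReal f (coordMul j (∂_{(Pi.single j 1 : Fin 3 → ℝ)} f))).integrable (μ := volume)
  have hleft : ∫ x, coordMul j f x * ∂_{(Pi.single j 1 : Fin 3 → ℝ)} f x
      = ∫ x, f x * (x j * ∂_{(Pi.single j 1 : Fin 3 → ℝ)} f x) := by
    congr 1 with x
    simp
    ring
  linarith

end Coordinates

/-- An integral depending polynomially on a parameter, with Schwartz coefficients, is
differentiable at `0` and its derivative is the integral of the linear coefficient. -/
theorem hasDerivAt_integral_quartic (f₀ f₁ f₂ f₃ f₄ : 𝓢(Fin 3 → ℝ, ℝ))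
    (g : ℝ → (Fin 3 → ℝ) → ℝ)
    (hg : ∀ ε x, g ε x = f₀ x + ε * f₁ x + ε ^ 2 * f₂ x + ε ^ 3 * f₃ x + ε ^ 4 * f₄ x) :
    HasDerivAt (fun ε => ∫ x, g ε x) (∫ x, f₁ x) 0 := by
  have hint (ε : ℝ) : ∫ x, g ε x = (∫ x, f₀ x) + ε * (∫ x, f₁ x) + ε ^ 2 * (∫ x, f₂ x)
      + ε ^ 3 * (∫ x, f₃ x) + ε ^ 4 * (∫ x, f₄ x) := by
    have h₀ := f₀.integrable (μ := volume)
    have h₁ := (f₁.integrable (μ := volume)).const_mul ε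
    have h₂ := (f₂.integrable (μ := volume)).const_mul (ε ^ 2)
    have h₃ := (f₃.integrable (μ := volume)).const_mul (ε ^ 3)
    have h₄ := (f₄.integrable (μ := volume)).const_mul (ε ^ 4)
    have h₀₁ := integral_add h₀ h₁
    have h₀₂ := integral_add (h₀.add h₁) h₂
    have h₀₃ := integral_add ((h₀.add h₁).add h₂) h₃
    have h₀₄ := integral_add (((h₀.add h₁).add h₂).add h₃) h₄
    simp only [Pi.add_apply, integral_const_mul] at h₀₁ h₀₂ h₀₃ h₀₄
    simp only [hg]
    rw [h₀₄, h₀₃, h₀₂, h₀₁]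
  simp_rw [hint]
  have hid := hasDerivAt_id (0 : ℝ)
  have hd := ((((hid.mul_const (∫ x, f₁ x)).const_add (∫ x, f₀ x)).add
    ((hid.pow 2).mul_const (∫ x, f₂ x))).add ((hid.pow 3).mul_const (∫ x, f₃ x))).add
    ((hid.pow 4).mul_const (∫ x, f₄ x))
  convert! hd using 1
  simp

/-- The weak form of the ground-state equation `-Δφ + φ = φ³`. -/
theorem groundState_weak (φ : 𝓢(Fin 3 → ℝ, ℝ))
    (hφ : ∀ x, -(∑ i : Fin 3, rPartialDeriv i (rPartialDeriv i ⇑φ) x) + φ x = (φ x) ^ 3)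
    (u : 𝓢(Fin 3 → ℝ, ℝ)) :
    ∑ i : Fin 3, ∫ x, ∂_{(Pi.single i 1 : Fin 3 → ℝ)} φ x * ∂_{(Pi.single i 1 : Fin 3 → ℝ)} u x
      = (∫ x, φ x ^ 3 * u x) - ∫ x, φ x * u x := by
  have hcube : Integrable (fun x => φ x ^ 3 * u x) := by
    convert! (mulReal (mulReal φ (mulReal φ φ)) u).integrable (μ := volume) using 2
    simp only [mulReal_apply]
    ring
  have hmul : Integrable (fun x => φ x * u x) := (mulReal φ u).integrable
  simp_rw [integral_mul_lineDerivOp_right_eq_neg_left]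
  rw [← integral_sub hcube hmul, Finset.sum_neg_distrib, ← integral_finsetSum, ← integral_neg]
  · congr 1 with x
    have hx := hφ x
    have hcoe (i : Fin 3) : rPartialDeriv i (rPartialDeriv i ⇑φ) x
        = ∂_{(Pi.single i 1 : Fin 3 → ℝ)} (∂_{(Pi.single i 1 : Fin 3 → ℝ)} φ) x := rfl
    simp_rw [hcoe] at hx
    rw [← sub_mul, ← hx, ← Finset.sum_mul]
    ring
  · exact fun i _ => (mulReal (∂_{(Pi.single i 1 : Fin 3 → ℝ)}
      (∂_{(Pi.single i 1 : Fin 3 → ℝ)} φ)) u).integrable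

/-- The Pohozaev identity for the ground state, combined with the virial identity. -/
theorem groundState_pohozaev (φ : 𝓢(Fin 3 → ℝ, ℝ))
    (hφ : ∀ x, -(∑ i : Fin 3, rPartialDeriv i (rPartialDeriv i ⇑φ) x) + φ x = (φ x) ^ 3) :
    (1 / 2) * (∑ i : Fin 3, ∫ x, ∂_{(Pi.single i 1 : Fin 3 → ℝ)} φ x ^ 2)
      + (3 / 2) * (∫ x, φ x ^ 2) = (3 / 4) * ∫ x, φ x ^ 4 := by
  have hdil (j : Fin 3) : (∫ x, ∂_{(Pi.single j 1 : Fin 3 → ℝ)} φ x ^ 2)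
      - (1 / 2) * (∑ i : Fin 3, ∫ x, ∂_{(Pi.single i 1 : Fin 3 → ℝ)} φ x ^ 2)
      = (1 / 2) * (∫ x, φ x ^ 2) - (1 / 4) * ∫ x, φ x ^ 4 := by
    have hweak := groundState_weak φ hφ (coordMul j (∂_{(Pi.single j 1 : Fin 3 → ℝ)} φ))
    have hgrad (i : Fin 3) : ∫ x, ∂_{(Pi.single i 1 : Fin 3 → ℝ)} φ x
          * ∂_{(Pi.single i 1 : Fin 3 → ℝ)} (coordMul j (∂_{(Pi.single j 1 : Fin 3 → ℝ)} φ)) x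
        = (if j = i then ∫ x, ∂_{(Pi.single j 1 : Fin 3 → ℝ)} φ x ^ 2 else 0)
          - (1 / 2) * ∫ x, ∂_{(Pi.single i 1 : Fin 3 → ℝ)} φ x ^ 2 := by
      have hcoord := integral_mul_coord_mul_lineDerivOp j (∂_{(Pi.single i 1 : Fin 3 → ℝ)} φ)
      have hfirst : (if j = i then ∫ x, ∂_{(Pi.single j 1 : Fin 3 → ℝ)} φ x ^ 2 else 0)
          = ∫ x, (Pi.single i 1 : Fin 3 → ℝ) j * (∂_{(Pi.single i 1 : Fin 3 → ℝ)} φ x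
            * ∂_{(Pi.single j 1 : Fin 3 → ℝ)} φ x) := by
        split_ifs with hji
        · subst hji
          simp [pow_two]
        · simp [hji]
      rw [hfirst, sub_eq_add_neg, ← neg_mul, ← hcoord, ← integral_add]
      · congr 1 with x
        rw [lineDerivOp_coordMul, lineDerivOp_swap (Pi.single i 1) (Pi.single j 1)]
        ring
      · exact ((mulReal (∂_{(Pi.single i 1 : Fin 3 → ℝ)} φ)
          (∂_{(Pi.single j 1 : Fin 3 → ℝ)} φ)).integrable).const_mul _
      · simpa only [mulReal_coe, coordMul_apply] using
          (mulReal (∂_{(Pi.single i 1 : Fin 3 → ℝ)} φ) (coordMul j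
          (∂_{(Pi.single j 1 : Fin 3 → ℝ)} (∂_{(Pi.single i 1 : Fin 3 → ℝ)} φ)))).integrable
          (μ := volume)
    have hquartic : ∫ x, φ x ^ 3 * coordMul j (∂_{(Pi.single j 1 : Fin 3 → ℝ)} φ) x
        = -(1 / 4) * ∫ x, φ x ^ 4 := by
      have hsq := integral_mul_coord_mul_lineDerivOp j (mulReal φ φ)
      have hl : ∫ x, mulReal φ φ x * (x j * ∂_{(Pi.single j 1 : Fin 3 → ℝ)} (mulReal φ φ) x)
          = 2 * ∫ x, φ x ^ 3 * coordMul j (∂_{(Pi.single j 1 : Fin 3 → ℝ)} φ) x := by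
        rw [← integral_const_mul]
        congr 1 with x
        rw [lineDerivOp_mulReal]
        simp
        ring
      have hr : ∫ x, mulReal φ φ x ^ 2 = ∫ x, φ x ^ 4 := by
        congr 1 with x
        simp
        ring
      linarith
    have hmass := integral_mul_coord_mul_lineDerivOp j φ
    simp_rw [hgrad, Finset.sum_sub_distrib, hquartic, coordMul_apply, hmass] at hweak
    rw [← Finset.mul_sum] at hweak
    simp only [Finset.sum_ite_eq, Finset.mem_univ, if_true] at hweak
    linarith
  have h₀ := hdil 0
  have h₁ := hdil 1
  have h₂ := hdil 2
  simp only [Fin.sum_univ_three] at *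
  linarith

/-- The virial and Pohozaev identities give `E[φ] = ½ M[φ]`. -/
theorem groundState_energy (φ : 𝓢(Fin 3 → ℝ, ℝ))
    (hφ : ∀ x, -(∑ i : Fin 3, rPartialDeriv i (rPartialDeriv i ⇑φ) x) + φ x = (φ x) ^ 3) :
    (1 / 2) * (∑ i : Fin 3, ∫ x, ∂_{(Pi.single i 1 : Fin 3 → ℝ)} φ x ^ 2)
      - (1 / 4) * (∫ x, φ x ^ 4) = (1 / 2) * ∫ x, φ x ^ 2 := by
  have hpoh := groundState_pohozaev φ hφ
  have hvir := groundState_weak φ hφ φ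
  simp only [← pow_succ, ← pow_two, Nat.reduceAdd] at hvir
  linarith

end SchwartzMap

theorem cPartialDeriv_perturbation (φ : 𝓢(Fin 3 → ℝ, ℝ)) (h : 𝓢(Fin 3 → ℝ, ℂ)) (ε : ℝ)
    (i : Fin 3) (x : Fin 3 → ℝ) :
    cPartialDeriv i (fun x => (φ x : ℂ) + ε * h x) x
      = (∂_{(Pi.single i 1 : Fin 3 → ℝ)} φ x : ℂ)
        + ε * ∂_{(Pi.single i 1 : Fin 3 → ℝ)} h x := by
  have hd := (Complex.ofRealCLM.hasFDerivAt.comp x (φ.hasFDerivAt x)).add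
    ((h.hasFDerivAt x).const_mul (ε : ℂ))
  have hf : fderiv ℝ (fun x => (φ x : ℂ) + ε * h x) x = _ := hd.fderiv
  rw [cPartialDeriv, hf]
  simp [lineDerivOp_apply_eq_fderiv]

/-- The real part of a complex-valued Schwartz function. -/
noncomputable def schwartzRe (h : 𝓢(Fin 3 → ℝ, ℂ)) : 𝓢(Fin 3 → ℝ, ℝ) :=
  postcompCLM Complex.reCLM h

/-- The imaginary part of a complex-valued Schwartz function. -/
noncomputable def schwartzIm (h : 𝓢(Fin 3 → ℝ, ℂ)) : 𝓢(Fin 3 → ℝ, ℝ) :=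
  postcompCLM Complex.imCLM h

theorem schwartzRe_apply (h : 𝓢(Fin 3 → ℝ, ℂ)) (x : Fin 3 → ℝ) :
    schwartzRe h x = (h x).re := rfl

theorem schwartzIm_apply (h : 𝓢(Fin 3 → ℝ, ℂ)) (x : Fin 3 → ℝ) :
    schwartzIm h x = (h x).im := rfl

theorem lineDerivOp_schwartzRe (v : Fin 3 → ℝ) (h : 𝓢(Fin 3 → ℝ, ℂ)) (x : Fin 3 → ℝ) :
    ∂_{v} (schwartzRe h) x = (∂_{v} h x).re := by
  have hf : fderiv ℝ (⇑(schwartzRe h)) x = _ :=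
    (Complex.reCLM.hasFDerivAt.comp x (h.hasFDerivAt x)).fderiv
  simp [lineDerivOp_apply_eq_fderiv, hf]

section Derivatives

variable (φ : 𝓢(Fin 3 → ℝ, ℝ)) (h : 𝓢(Fin 3 → ℝ, ℂ))

theorem hasDerivAt_massNLS :
    HasDerivAt (fun ε : ℝ => massNLS (fun x => (φ x : ℂ) + ε * h x))
      (2 * ∫ x, φ x * schwartzRe h x) 0 := by
  have hd := hasDerivAt_integral_quartic (mulReal φ φ) ((2 : ℝ) • mulReal φ (schwartzRe h))
    (mulReal (schwartzRe h) (schwartzRe h) + mulReal (schwartzIm h) (schwartzIm h)) 0 0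
    (fun ε x => ‖(φ x : ℂ) + ε * h x‖ ^ 2) fun ε x => by
      rw [Complex.sq_norm, Complex.normSq_apply]
      simp [schwartzRe_apply, schwartzIm_apply]
      ring
  simpa [massNLS, integral_const_mul] using hd

theorem hasDerivAt_momentumNLS (i : Fin 3) :
    ∃ p, HasDerivAt (fun ε : ℝ => momentumNLS (fun x => (φ x : ℂ) + ε * h x) i) p 0 := by
  set e : Fin 3 → ℝ := Pi.single i 1 with he
  have hd := hasDerivAt_integral_quartic 0
    (mulReal φ (schwartzIm (∂_{e} h)) - mulReal (∂_{e} φ) (schwartzIm h))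
    (mulReal (schwartzRe h) (schwartzIm (∂_{e} h)) - mulReal (schwartzIm h) (schwartzRe (∂_{e} h)))
    0 0 (fun ε x => ((starRingEnd ℂ) ((φ x : ℂ) + ε * h x)
      * cPartialDeriv i (fun x => (φ x : ℂ) + ε * h x) x).im) fun ε x => by
      rw [cPartialDeriv_perturbation, ← he]
      simp [schwartzRe_apply, schwartzIm_apply]
      ring
  exact ⟨_, hd⟩

theorem hasDerivAt_energyNLS :
    HasDerivAt (fun ε : ℝ => energyNLS (fun x => (φ x : ℂ) + ε * h x))
      ((∑ i : Fin 3, ∫ x, ∂_{(Pi.single i 1 : Fin 3 → ℝ)} φ x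
        * ∂_{(Pi.single i 1 : Fin 3 → ℝ)} (schwartzRe h) x)
        - ∫ x, φ x ^ 3 * schwartzRe h x) 0 := by
  set e : Fin 3 → Fin 3 → ℝ := fun i => Pi.single i 1 with he
  set u := schwartzRe h with hu
  set v := schwartzIm h with hv
  set s := mulReal u u + mulReal v v with hs
  let cube := mulReal (mulReal φ (mulReal φ φ)) u
  let grad (i : Fin 3) := mulReal (∂_{e i} φ) (∂_{e i} u)
  have hd := hasDerivAt_integral_quartic
    ((1 / 2 : ℝ) • ∑ i, mulReal (∂_{e i} φ) (∂_{e i} φ)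
      - (1 / 4 : ℝ) • mulReal (mulReal φ φ) (mulReal φ φ))
    (∑ i, grad i - cube)
    ((1 / 2 : ℝ) • ∑ i, (mulReal (schwartzRe (∂_{e i} h)) (schwartzRe (∂_{e i} h))
        + mulReal (schwartzIm (∂_{e i} h)) (schwartzIm (∂_{e i} h)))
      - ((1 / 2 : ℝ) • mulReal (mulReal φ φ) s + mulReal (mulReal φ u) (mulReal φ u)))
    (-mulReal (mulReal φ u) s)
    (-((1 / 4 : ℝ) • mulReal s s))
    (fun ε x => (1 / 2) * ∑ i : Fin 3, ‖cPartialDeriv i (fun x => (φ x : ℂ) + ε * h x) x‖ ^ 2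
      - (1 / 4) * ‖(φ x : ℂ) + ε * h x‖ ^ 4) fun ε x => by
      have hfour (z : ℂ) : ‖z‖ ^ 4 = Complex.normSq z ^ 2 := by
        rw [← Complex.sq_norm, ← pow_mul]
      simp only [cPartialDeriv_perturbation, hfour, Complex.sq_norm, Complex.normSq_apply]
      simp [grad, cube, hs, hu, hv, he, lineDerivOp_schwartzRe, schwartzRe_apply,
        schwartzIm_apply, Fin.sum_univ_three]
      ring
  convert! hd using 1
  have hcube : (fun x => φ x ^ 3 * u x) = cube := by
    ext x
    simp only [cube, mulReal_apply]
    ring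
  have hsum : ∫ x, (∑ i, grad i - cube) x = (∑ i, ∫ x, grad i x) - ∫ x, cube x := by
    simp only [sub_apply, sum_apply]
    rw [integral_sub (integrable_finsetSum _ fun i _ => (grad i).integrable) cube.integrable,
      integral_finsetSum _ fun i _ => (grad i).integrable]
  rw [hsum, hcube]
  rfl

theorem cPartialDeriv_ofReal (i : Fin 3) (x : Fin 3 → ℝ) :
    cPartialDeriv i (fun x => (φ x : ℂ)) x = (∂_{(Pi.single i 1 : Fin 3 → ℝ)} φ x : ℂ) := by
  simpa using cPartialDeriv_perturbation φ 0 0 i x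

theorem massNLS_ofReal : massNLS (fun x => (φ x : ℂ)) = ∫ x, φ x ^ 2 := by
  simp [massNLS]

theorem momentumNLS_ofReal (i : Fin 3) : momentumNLS (fun x => (φ x : ℂ)) i = 0 := by
  simp [momentumNLS, cPartialDeriv_ofReal]

theorem energyNLS_ofReal : energyNLS (fun x => (φ x : ℂ))
    = (1 / 2) * (∑ i : Fin 3, ∫ x, ∂_{(Pi.single i 1 : Fin 3 → ℝ)} φ x ^ 2)
      - (1 / 4) * ∫ x, φ x ^ 4 := by
  have hsq (i : Fin 3) : Integrable (fun x => ∂_{(Pi.single i 1 : Fin 3 → ℝ)} φ x ^ 2) := by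
    simpa only [pow_two, mulReal_coe] using (mulReal (∂_{(Pi.single i 1 : Fin 3 → ℝ)} φ)
      (∂_{(Pi.single i 1 : Fin 3 → ℝ)} φ)).integrable (μ := volume)
  have hfour : Integrable (fun x => φ x ^ 4) := by
    convert! (mulReal (mulReal φ φ) (mulReal φ φ)).integrable (μ := volume) using 2
    simp
    ring
  have habs (t : ℝ) : |t| ^ 4 = t ^ 4 := Even.pow_abs (by decide) t
  simp only [energyNLS, cPartialDeriv_ofReal, Complex.norm_real, Real.norm_eq_abs, sq_abs, habs]
  rw [integral_sub ((integrable_finsetSum _ fun i _ => hsq i).const_mul _) (hfour.const_mul _),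
    integral_const_mul, integral_const_mul, integral_finsetSum _ fun i _ => hsq i]

end Derivatives

/-- Criticality of the ground state for `F = M·E − 2|P|²`: if a positive Schwartz
function `φ` solves `−Δφ + φ = φ³`, then the first differential of `F` at `φ`
vanishes in every Schwartz direction `h`. -/
theorem first_differential_of_F_at_ground_state_vanishes
    (φ : SchwartzMap (Fin 3 → ℝ) ℝ) (hpos : ∀ x, 0 < φ x)
    (hφ : ∀ x, -(∑ i : Fin 3, rPartialDeriv i (rPartialDeriv i ⇑φ) x) + φ x = (φ x) ^ 3)
    (h : SchwartzMap (Fin 3 → ℝ) ℂ) :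
    Filter.Tendsto
      (fun ε : ℝ =>
        (funcF (fun x => (φ x : ℂ) + ε * h x) - funcF (fun x => (φ x : ℂ))) / ε)
      (nhdsWithin 0 {0}ᶜ) (nhds 0) := by
  have hM := hasDerivAt_massNLS φ h
  have hE := hasDerivAt_energyNLS φ h
  choose p hP using hasDerivAt_momentumNLS φ h
  have hF := (hM.mul hE).sub
    ((HasDerivAt.fun_sum (u := Finset.univ) fun i _ => (hP i).pow 2).const_mul 2)
  have hzero : HasDerivAt (fun ε : ℝ => funcF (fun x => (φ x : ℂ) + ε * h x)) 0 0 := by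
    convert! hF using 1
    simp only [Complex.ofReal_zero, zero_mul, add_zero, massNLS_ofReal, energyNLS_ofReal,
      momentumNLS_ofReal, groundState_energy φ hφ, groundState_weak φ hφ]
    simp
    ring
  simpa [div_eq_inv_mul] using hasDerivAt_iff_tendsto_slope_zero.mp hzero
end

section
/- Fix a > 0 and for natural numbers n and reals t ≥ 0 define A_n(t) = ∑_{j=0}^{n} ⟨a t⟩^j / j!, where ⟨x⟩ = (1 + x²)^{1/2}. Then for every natural number n and every t ≥ 0, ∑_{j=0}^{n} A_j(t) · A_{n−j}(t) ≤ 4^n · A_n(t). -/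
/-- The truncated exponential weight `A_n(t) = ∑_{j=0}^{n} ⟨a t⟩^j / j!`, where
`⟨x⟩ = (1 + x²)^{1/2}` is the Japanese bracket. -/
noncomputable def truncExpWeight (a : ℝ) (n : ℕ) (t : ℝ) : ℝ :=
  ∑ j ∈ Finset.range (n + 1), Real.sqrt (1 + (a * t) ^ 2) ^ j / (Nat.factorial j : ℝ)

/-- Convolving with the partial sums of `e`: passing from `n` to `n + 1` adds the convolution
with `e` itself. -/
lemma Finset.sum_mul_partialSum_succ (f e : ℕ → ℝ) (n : ℕ) :
    ∑ j ∈ Finset.range (n + 2), f j * ∑ i ∈ Finset.range (n + 1 - j + 1), e i =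
      ∑ j ∈ Finset.range (n + 1), f j * ∑ i ∈ Finset.range (n - j + 1), e i +
        ∑ j ∈ Finset.range (n + 2), f j * e (n + 1 - j) := by
  rw [Finset.sum_range_succ, Finset.sum_range_succ (n := n + 1), ← add_assoc,
    ← Finset.sum_add_distrib]
  congr 1
  · refine Finset.sum_congr rfl fun j hj => ?_
    have hj' : n + 1 - j = n - j + 1 := by have := Finset.mem_range.1 hj; omega
    rw [hj', Finset.sum_range_succ, mul_add]
  · simp

/-- The binomial theorem in terms of the divided powers `x ^ j / j!`. -/
lemma sum_pow_div_factorial_mul (x y : ℝ) (n : ℕ) :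
    ∑ j ∈ Finset.range (n + 1),
      x ^ j / (Nat.factorial j : ℝ) * (y ^ (n - j) / (Nat.factorial (n - j) : ℝ)) =
      (x + y) ^ n / (Nat.factorial n : ℝ) := by
  rw [add_pow, Finset.sum_div]
  refine Finset.sum_congr rfl fun j hj => ?_
  rw [Nat.cast_choose ℝ (Finset.mem_range_succ_iff.1 hj)]
  have := Nat.factorial_ne_zero n
  field_simp

lemma sum_pow_div_factorial_mul_partialSum_le (x : ℝ) (hx : 0 ≤ x) (n : ℕ) :
    ∑ j ∈ Finset.range (n + 1), x ^ j / (Nat.factorial j : ℝ) *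
        ∑ i ∈ Finset.range (n - j + 1), x ^ i / (Nat.factorial i : ℝ) ≤
      2 ^ n * ∑ i ∈ Finset.range (n + 1), x ^ i / (Nat.factorial i : ℝ) := by
  induction n with
  | zero => simp
  | succ n ih =>
    rw [Finset.sum_mul_partialSum_succ _ (fun i => x ^ i / (Nat.factorial i : ℝ)),
      sum_pow_div_factorial_mul, Finset.sum_range_succ _ (n + 1), mul_add, ← two_mul, mul_pow,
      mul_div_assoc, pow_succ]
    have h : 0 ≤ 2 ^ n * ∑ i ∈ Finset.range (n + 1), x ^ i / (Nat.factorial i : ℝ) := by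
      positivity
    linarith

lemma sum_partialSum_mul_partialSum_le (x : ℝ) (hx : 0 ≤ x) (n : ℕ) :
    ∑ j ∈ Finset.range (n + 1), (∑ i ∈ Finset.range (j + 1), x ^ i / (Nat.factorial i : ℝ)) *
        ∑ i ∈ Finset.range (n - j + 1), x ^ i / (Nat.factorial i : ℝ) ≤
      2 ^ n * ∑ i ∈ Finset.range (n + 1), x ^ i / (Nat.factorial i : ℝ) := by
  induction n with
  | zero => simp
  | succ n ih =>
    have hT : ∑ j ∈ Finset.range (n + 2),
        (∑ i ∈ Finset.range (j + 1), x ^ i / (Nat.factorial i : ℝ)) *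
          (x ^ (n + 1 - j) / (Nat.factorial (n + 1 - j) : ℝ)) ≤
        2 ^ n * ∑ i ∈ Finset.range (n + 1), x ^ i / (Nat.factorial i : ℝ) +
          (2 * x) ^ (n + 1) / (Nat.factorial (n + 1) : ℝ) := by
      rw [← Finset.sum_range_reflect]
      refine le_trans (le_of_eq ?_)
        (add_le_add_left (sum_pow_div_factorial_mul_partialSum_le x hx n) _)
      rw [two_mul, ← sum_pow_div_factorial_mul,
        ← Finset.sum_mul_partialSum_succ _ (fun i => x ^ i / (Nat.factorial i : ℝ))]
      refine Finset.sum_congr rfl fun j hj => ?_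
      have hj' := Finset.mem_range.1 hj
      have h1 : n + 2 - 1 - j = n + 1 - j := by omega
      have h2 : n + 1 - (n + 1 - j) = j := by omega
      rw [h1, h2, mul_comm]
    rw [Finset.sum_mul_partialSum_succ _ (fun i => x ^ i / (Nat.factorial i : ℝ)),
      Finset.sum_range_succ (fun i => x ^ i / (Nat.factorial i : ℝ)) (n + 1), mul_add]
    rw [mul_pow, mul_div_assoc] at hT
    rw [pow_succ] at hT ⊢
    linarith

/-- Submultiplicativity of the truncated exponential weights:
`∑_{j=0}^{n} A_j(t) A_{n−j}(t) ≤ 4^n A_n(t)`. -/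
theorem truncExpWeight_convolution_le (a : ℝ) (ha : 0 < a) (n : ℕ) (t : ℝ)
    (ht : 0 ≤ t) :
    ∑ j ∈ Finset.range (n + 1), truncExpWeight a j t * truncExpWeight a (n - j) t ≤
      4 ^ n * truncExpWeight a n t := by
  have hA : 0 ≤ truncExpWeight a n t := by unfold truncExpWeight; positivity
  calc _ ≤ 2 ^ n * truncExpWeight a n t :=
        sum_partialSum_mul_partialSum_le _ (Real.sqrt_nonneg _) n
    _ ≤ 4 ^ n * truncExpWeight a n t := by gcongr; norm_num
end

section
/- Fix 0 < a < a₁ and for natural numbers n and reals t ≥ 0 define A_n(t) = ∑_{j=0}^{n} ⟨a t⟩^j / j!, where ⟨x⟩ = (1 + x²)^{1/2}. Then for every natural number n and every t ≥ 0: (i) ∫₀^t e^{−a₁(t−s)} A_n(s) ds ≤ (1/a₁) · A_n(t), and (ii) ∫_t^∞ e^{a₁(t−s)} A_n(s) ds ≤ (1/(a₁ − a)) · A_n(t). In particular the constants are independent of n and t. -/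
open MeasureTheory

theorem hasDerivAt_truncExp_mul_exp_neg (n : ℕ) (u : ℝ) :
    HasDerivAt (fun x : ℝ => (∑ j ∈ Finset.range (n + 1), x ^ j / (Nat.factorial j : ℝ)) *
      Real.exp (-x)) (-(u ^ n / (Nat.factorial n : ℝ)) * Real.exp (-u)) u := by
  have hexp : HasDerivAt (fun x : ℝ => Real.exp (-x)) (-Real.exp (-u)) u := by
    simpa using (hasDerivAt_neg u).exp
  induction n with
  | zero => simpa using hexp
  | succ n ih =>
    have hpow := (((hasDerivAt_pow (n + 1) u).div_const (Nat.factorial (n + 1) : ℝ)).mul hexp)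
    refine ((ih.add hpow).congr_deriv ?_).congr_of_eventuallyEq (.of_forall fun x => ?_)
    rotate_left
    · simp only [Pi.add_apply, Pi.mul_apply]
      rw [Finset.sum_range_succ _ (n + 1)]
      ring
    · have hn : (Nat.factorial n : ℝ) ≠ 0 := by positivity
      rw [Nat.factorial_succ]
      push_cast
      field_simp
      ring

theorem truncExp_le_truncExp_mul_exp_sub (n : ℕ) {u v : ℝ} (hu : 0 ≤ u) (huv : u ≤ v) :
    ∑ j ∈ Finset.range (n + 1), v ^ j / (Nat.factorial j : ℝ) ≤
      (∑ j ∈ Finset.range (n + 1), u ^ j / (Nat.factorial j : ℝ)) * Real.exp (v - u) := by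
  have hanti : AntitoneOn (fun x : ℝ =>
      (∑ j ∈ Finset.range (n + 1), x ^ j / (Nat.factorial j : ℝ)) * Real.exp (-x))
      (Set.Ici 0) := by
    refine antitoneOn_of_deriv_nonpos (convex_Ici 0)
      (fun x _ => (hasDerivAt_truncExp_mul_exp_neg n x).continuousAt.continuousWithinAt)
      (fun x _ => (hasDerivAt_truncExp_mul_exp_neg n x).differentiableAt.differentiableWithinAt)
      fun x hx => ?_
    rw [interior_Ici, Set.mem_Ioi] at hx
    rw [(hasDerivAt_truncExp_mul_exp_neg n x).deriv, neg_mul, neg_nonpos]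
    positivity
  have h := mul_le_mul_of_nonneg_right (hanti hu (hu.trans huv) huv) (Real.exp_pos v).le
  simp only [mul_assoc, ← Real.exp_add, neg_add_cancel, Real.exp_zero, mul_one] at h
  rwa [neg_add_eq_sub] at h

theorem sqrt_one_add_sq_le_add_sub {x y : ℝ} (hxy : x ≤ y) :
    Real.sqrt (1 + y ^ 2) ≤ Real.sqrt (1 + x ^ 2) + (y - x) := by
  have hx : x ≤ Real.sqrt (1 + x ^ 2) := Real.le_sqrt_of_sq_le (by linarith)
  have hsq : Real.sqrt (1 + x ^ 2) ^ 2 = 1 + x ^ 2 := Real.sq_sqrt (by positivity)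
  refine Real.sqrt_le_iff.mpr ⟨add_nonneg (Real.sqrt_nonneg _) (sub_nonneg.mpr hxy), ?_⟩
  nlinarith [mul_nonneg (sub_nonneg.mpr hx) (sub_nonneg.mpr hxy)]

theorem truncExpWeight_nonneg (a : ℝ) (n : ℕ) (t : ℝ) : 0 ≤ truncExpWeight a n t := by
  unfold truncExpWeight
  positivity

theorem continuous_truncExpWeight (a : ℝ) (n : ℕ) : Continuous (truncExpWeight a n) := by
  unfold truncExpWeight
  fun_prop

theorem sqrt_one_add_sq_mono {a s t : ℝ} (ha : 0 ≤ a) (hs : 0 ≤ s) (hst : s ≤ t) :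
    Real.sqrt (1 + (a * s) ^ 2) ≤ Real.sqrt (1 + (a * t) ^ 2) := by
  gcongr

theorem truncExpWeight_mono {a : ℝ} (ha : 0 ≤ a) (n : ℕ) {s t : ℝ} (hs : 0 ≤ s) (hst : s ≤ t) :
    truncExpWeight a n s ≤ truncExpWeight a n t := by
  unfold truncExpWeight
  gcongr

theorem truncExpWeight_le_mul_exp {a : ℝ} (ha : 0 ≤ a) (n : ℕ) {s t : ℝ} (ht : 0 ≤ t)
    (hts : t ≤ s) :
    truncExpWeight a n s ≤ truncExpWeight a n t * Real.exp (a * (s - t)) := by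
  refine (truncExp_le_truncExp_mul_exp_sub n (Real.sqrt_nonneg _)
    (sqrt_one_add_sq_mono ha ht hts)).trans ?_
  refine mul_le_mul_of_nonneg_left (Real.exp_le_exp.mpr ?_) (truncExpWeight_nonneg a n t)
  linarith [sqrt_one_add_sq_le_add_sub (mul_le_mul_of_nonneg_left hts ha)]

/-- Convolution estimates for the truncated exponential weights against decaying
exponentials: for `0 < a < a₁`, `∫₀^t e^{−a₁(t−s)} A_n(s) ds ≤ A_n(t)/a₁` and
`∫_t^∞ e^{a₁(t−s)} A_n(s) ds ≤ A_n(t)/(a₁ − a)`, with constants independent of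
`n` and `t`. -/
theorem truncExpWeight_exp_convolution_le (a a₁ : ℝ) (ha : 0 < a) (haa : a < a₁)
    (n : ℕ) (t : ℝ) (ht : 0 ≤ t) :
    (∫ s in (0 : ℝ)..t, Real.exp (-a₁ * (t - s)) * truncExpWeight a n s) ≤
        (1 / a₁) * truncExpWeight a n t ∧
      (∫ s in Set.Ioi t, Real.exp (a₁ * (t - s)) * truncExpWeight a n s) ≤
        (1 / (a₁ - a)) * truncExpWeight a n t := by
  have ha₁ : 0 < a₁ := ha.trans haa
  constructor
  · have hcont := continuous_truncExpWeight a n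
    have hderiv : ∀ s ∈ Set.uIcc 0 t, HasDerivAt (fun s => Real.exp (-a₁ * (t - s)) / a₁)
        (Real.exp (-a₁ * (t - s))) s := by
      intro s _
      have h := ((((hasDerivAt_id s).const_sub t).const_mul (-a₁)).exp).div_const a₁
      refine h.congr_deriv ?_
      simp only [id_eq]
      field_simp
    calc (∫ s in (0 : ℝ)..t, Real.exp (-a₁ * (t - s)) * truncExpWeight a n s)
        ≤ ∫ s in (0 : ℝ)..t, Real.exp (-a₁ * (t - s)) * truncExpWeight a n t := by
          refine intervalIntegral.integral_mono_on ht
            (Continuous.intervalIntegrable (by fun_prop) _ _)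
            (Continuous.intervalIntegrable (by fun_prop) _ _) fun s hs => ?_
          gcongr
          exact truncExpWeight_mono ha.le n hs.1 hs.2
      _ = (1 / a₁ - Real.exp (-a₁ * t) / a₁) * truncExpWeight a n t := by
          rw [intervalIntegral.integral_mul_const,
            intervalIntegral.integral_eq_sub_of_hasDerivAt hderiv
              (Continuous.intervalIntegrable (by fun_prop) _ _)]
          simp
      _ ≤ (1 / a₁) * truncExpWeight a n t := by
          refine mul_le_mul_of_nonneg_right (sub_le_self _ ?_) (truncExpWeight_nonneg a n t)
          positivity
  · have hneg : a - a₁ < 0 := sub_neg.mpr haa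
    calc (∫ s in Set.Ioi t, Real.exp (a₁ * (t - s)) * truncExpWeight a n s)
        ≤ ∫ s in Set.Ioi t,
            truncExpWeight a n t * Real.exp ((a₁ - a) * t) * Real.exp ((a - a₁) * s) := by
          refine integral_mono_of_nonneg
            (.of_forall fun s => mul_nonneg (Real.exp_pos _).le (truncExpWeight_nonneg a n s))
            ((integrableOn_exp_mul_Ioi hneg t).const_mul _) ?_
          filter_upwards [ae_restrict_mem measurableSet_Ioi] with s hs
          calc Real.exp (a₁ * (t - s)) * truncExpWeight a n s
              ≤ Real.exp (a₁ * (t - s)) * (truncExpWeight a n t * Real.exp (a * (s - t))) := by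
                gcongr
                exact truncExpWeight_le_mul_exp ha.le n ht (le_of_lt hs)
            _ = truncExpWeight a n t * Real.exp ((a₁ - a) * t) * Real.exp ((a - a₁) * s) := by
                rw [mul_left_comm, mul_assoc, ← Real.exp_add, ← Real.exp_add]
                ring_nf
      _ = (1 / (a₁ - a)) * truncExpWeight a n t := by
          rw [integral_const_mul, integral_exp_mul_Ioi hneg, ← neg_sub a₁ a, neg_div_neg_eq,
            mul_assoc, mul_div_assoc', ← Real.exp_add]
          rw [show (a₁ - a) * t + -(a₁ - a) * t = 0 by ring, Real.exp_zero]
          ring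
end
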